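/- arXiv:1210.4494 — 5 statements merged into one kernel-verified Lean document; each statement's English description precedes it below -/
import Mathlib

section
/- Let p be a prime with p ≡ 1 (mod 3), t a positive integer divisible by 3, r = p^t, and α a generator of GF(r)^*. Then the three Gaussian periods satisfy: η_1^{(3,r)} = ((−1)^{t+1} p^{t/3}(π^{t/3} + π̄^{t/3}) − 1)/3; η_α^{(3,r)} = ((−1)^{t+1} p^{t/3}(u(α)² π^{t/3} + u(α) π̄^{t/3}) − 1)/3; and η_{α²}^{(3,r)} = ((−1)^{t+1} p^{t/3}(u(α) π^{t/3} + u(α)² π̄^{t/3}) − 1)/3. -/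
open scoped Classical
open Polynomial Finset

/-- The number of powers of `P` dividing `f` is the multiplicity of `P` in `f`. -/
theorem card_pow_dvd_eq_count {K : Type*} [Field K] {f P : K[X]} (hf : f.Monic) (hP : P.Monic)
    (hi : Irreducible P) {B : ℕ} (hB : f.natDegree ≤ B) :
    #{k ∈ Icc 1 B | P ^ k ∣ f} =
      (UniqueFactorizationMonoid.normalizedFactors f).count P := by
  have key : ∀ k : ℕ, P ^ k ∣ f ↔
      k ≤ (UniqueFactorizationMonoid.normalizedFactors f).count P := by
    intro k
    rw [pow_dvd_iff_le_emultiplicity,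
      UniqueFactorizationMonoid.emultiplicity_eq_count_normalizedFactors hi hf.ne_zero,
      hP.normalize_eq_self, Nat.cast_le]
  have hle : (UniqueFactorizationMonoid.normalizedFactors f).count P ≤ B := by
    have h := natDegree_le_of_dvd ((key _).mpr le_rfl) hf.ne_zero
    rw [natDegree_pow] at h
    have := hi.natDegree_pos
    nlinarith
  have : {k ∈ Icc 1 B | P ^ k ∣ f} =
      Icc 1 ((UniqueFactorizationMonoid.normalizedFactors f).count P) := by
    ext k
    simp only [mem_filter, mem_Icc, key]
    omega
  rw [this, Nat.card_Icc, Nat.add_sub_cancel]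

section MonicSums

variable {K : Type*} [Field K] [Finite K]

theorem Polynomial.finite_monic_natDegree_eq (n : ℕ) :
    {f : K[X] | f.Monic ∧ f.natDegree = n}.Finite := by
  have : Finite (degreeLT K (n + 1)) := Module.finite_of_finite K
  refine (Set.toFinite (degreeLT K (n + 1) : Set K[X])).subset fun f hf => ?_
  rw [SetLike.mem_coe, mem_degreeLT, degree_lt_iff_coeff_zero]
  exact fun m hm => coeff_eq_zero_of_natDegree_lt (by have := hf.2; omega)

/-- The monic polynomials of degree `n` over a finite field. -/
noncomputable def monicsOfDegree (K : Type*) [Field K] [Finite K] (n : ℕ) : Finset K[X] :=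
  (finite_monic_natDegree_eq (K := K) n).toFinset

@[simp]
theorem mem_monicsOfDegree {n : ℕ} {f : K[X]} :
    f ∈ monicsOfDegree K n ↔ f.Monic ∧ f.natDegree = n := by
  simp [monicsOfDegree]

/-- The monic irreducible polynomials of degree at most `B` over a finite field. -/
noncomputable def monicIrreducibles (K : Type*) [Field K] [Finite K] (B : ℕ) : Finset K[X] :=
  {f ∈ (range (B + 1)).biUnion (monicsOfDegree K) | Irreducible f}

@[simp]
theorem mem_monicIrreducibles {B : ℕ} {f : K[X]} :
    f ∈ monicIrreducibles K B ↔ f.Monic ∧ f.natDegree ≤ B ∧ Irreducible f := by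
  simp only [monicIrreducibles, mem_filter, mem_biUnion, mem_range, mem_monicsOfDegree]
  constructor
  · rintro ⟨⟨n, hn, hf, rfl⟩, hi⟩
    exact ⟨hf, by omega, hi⟩
  · rintro ⟨hf, hn, hi⟩
    exact ⟨⟨_, by omega, hf, rfl⟩, hi⟩

theorem monicsOfDegree_zero : monicsOfDegree K 0 = {1} := by
  ext f
  rw [mem_monicsOfDegree, mem_singleton]
  constructor
  · rintro ⟨hf, h0⟩
    exact hf.natDegree_eq_zero.mp h0
  · rintro rfl
    exact ⟨monic_one, natDegree_one⟩

/-- The degree of a monic polynomial, counted through the prime powers dividing it. -/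
theorem natDegree_eq_sum_pow_dvd {f : K[X]} (hf : f.Monic) {B : ℕ} (hB : f.natDegree ≤ B) :
    f.natDegree = ∑ P ∈ monicIrreducibles K B, ∑ k ∈ Icc 1 B,
      if P ^ k ∣ f then P.natDegree else 0 := by
  have hfac : ∀ P ∈ UniqueFactorizationMonoid.normalizedFactors f,
      P.Monic ∧ P.natDegree ≤ B ∧ Irreducible P := by
    intro P hP
    have hi := UniqueFactorizationMonoid.irreducible_of_normalized_factor P hP
    refine ⟨?_, (natDegree_le_of_dvd
      (UniqueFactorizationMonoid.dvd_of_mem_normalizedFactors hP) hf.ne_zero).trans hB, hi⟩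
    rw [← UniqueFactorizationMonoid.normalize_normalized_factor P hP]
    exact monic_normalize hi.ne_zero
  have hprod : (UniqueFactorizationMonoid.normalizedFactors f).prod = f := by
    rw [UniqueFactorizationMonoid.prod_normalizedFactors_eq hf.ne_zero, hf.normalize_eq_self]
  conv_lhs => rw [← hprod]
  rw [natDegree_multiset_prod_of_monic _ fun P hP => (hfac P hP).1,
    sum_multiset_map_count]
  rw [sum_subset (s₂ := monicIrreducibles K B)
    (fun P hP => by simpa using hfac P (Multiset.mem_toFinset.mp hP))
    (fun P _ hP => by
      rw [Multiset.mem_toFinset] at hP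
      rw [Multiset.count_eq_zero_of_notMem hP, zero_smul])]
  refine sum_congr rfl fun P hP => ?_
  obtain ⟨hm, -, hi⟩ := mem_monicIrreducibles.mp hP
  rw [← sum_filter, sum_const, card_pow_dvd_eq_count hf hm hi hB]

variable {R : Type*} [CommRing R]

/-- Sum of `w` over the monic multiples, of degree `n`, of a monic polynomial. -/
theorem sum_monicsOfDegree_dvd {w : K[X] → R}
    (hw : ∀ f g : K[X], f.Monic → g.Monic → w (f * g) = w f * w g)
    {Q : K[X]} (hQ : Q.Monic) (n : ℕ) :
    (∑ f ∈ monicsOfDegree K n with Q ∣ f, w f) =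
      if Q.natDegree ≤ n then w Q * ∑ g ∈ monicsOfDegree K (n - Q.natDegree), w g else 0 := by
  split_ifs with h
  · rw [mul_sum]
    symm
    refine sum_bij (fun g _ => Q * g) ?_ ?_ ?_ ?_
    · intro g hg
      rw [mem_monicsOfDegree] at hg
      rw [mem_filter, mem_monicsOfDegree]
      refine ⟨⟨hQ.mul hg.1, ?_⟩, dvd_mul_right _ _⟩
      rw [hQ.natDegree_mul hg.1]
      omega
    · intro g _ g' _ he
      exact mul_left_cancel₀ hQ.ne_zero he
    · intro f hf
      rw [mem_filter, mem_monicsOfDegree] at hf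
      obtain ⟨⟨hf, hd⟩, g, rfl⟩ := hf
      have hg := hQ.of_mul_monic_left hf
      refine ⟨g, ?_, rfl⟩
      rw [hQ.natDegree_mul hg] at hd
      rw [mem_monicsOfDegree]
      exact ⟨hg, by omega⟩
    · intro g hg
      rw [mem_monicsOfDegree] at hg
      exact (hw _ _ hQ hg.1).symm
  · refine sum_eq_zero fun f hf => ?_
    rw [mem_filter, mem_monicsOfDegree] at hf
    have := natDegree_le_of_dvd hf.2 hf.1.1.ne_zero
    omega

/-- The logarithmic derivative of the Euler product of `∑ w f * T ^ f.natDegree`, coefficientwise. -/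
theorem natCast_mul_sum_monicsOfDegree {w : K[X] → R} (hone : w 1 = 1)
    (hw : ∀ f g : K[X], f.Monic → g.Monic → w (f * g) = w f * w g)
    {n B : ℕ} (hB : n ≤ B) :
    (n : R) * ∑ f ∈ monicsOfDegree K n, w f =
      ∑ P ∈ monicIrreducibles K B, ∑ k ∈ Icc 1 B,
        if k * P.natDegree ≤ n then
          P.natDegree * w P ^ k * ∑ g ∈ monicsOfDegree K (n - k * P.natDegree), w g
        else 0 := by
  have hpow : ∀ P : K[X], P.Monic → ∀ k, w (P ^ k) = w P ^ k := by
    intro P hP k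
    induction k with
    | zero => simpa using hone
    | succ k ih => rw [pow_succ, hw _ _ (hP.pow k) hP, ih, pow_succ]
  have h1 : ∀ f ∈ monicsOfDegree K n, (n : R) * w f =
      ∑ P ∈ monicIrreducibles K B, ∑ k ∈ Icc 1 B,
        if P ^ k ∣ f then P.natDegree * w f else 0 := by
    intro f hf
    obtain ⟨hm, rfl⟩ := mem_monicsOfDegree.mp hf
    conv_lhs => rw [natDegree_eq_sum_pow_dvd hm hB]
    push_cast
    simp only [sum_mul, ite_mul, zero_mul]
  rw [mul_sum, sum_congr rfl h1, sum_comm]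
  refine sum_congr rfl fun P hP => ?_
  rw [sum_comm]
  refine sum_congr rfl fun k _ => ?_
  have hm := (mem_monicIrreducibles.mp hP).1
  rw [← sum_filter, ← mul_sum, sum_monicsOfDegree_dvd hw (hm.pow k), hpow P hm, natDegree_pow,
    mul_ite, mul_zero, mul_assoc]

/-- The power sum attached to `w`: the sum over monic irreducibles `P` and `k` with
`k * P.natDegree = s` of `P.natDegree * w P ^ k`. -/
noncomputable def primePowerSum (w : K[X] → R) (B s : ℕ) : R :=
  ∑ P ∈ monicIrreducibles K B, ∑ k ∈ Icc 1 B,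
    if k * P.natDegree = s then P.natDegree * w P ^ k else 0

/-- If the sums of a completely multiplicative `w` over monic polynomials of degree at least two
vanish, its power sums are those of a single number. -/
theorem primePowerSum_eq {w : K[X] → R} (hone : w 1 = 1)
    (hw : ∀ f g : K[X], f.Monic → g.Monic → w (f * g) = w f * w g)
    (hzero : ∀ n, 2 ≤ n → ∑ f ∈ monicsOfDegree K n, w f = 0)
    {B s : ℕ} (hs : 1 ≤ s) (hB : s ≤ B) :
    primePowerSum w B s = (-1) ^ (s + 1) * (∑ f ∈ monicsOfDegree K 1, w f) ^ s := by
  have hE0 : ∑ f ∈ monicsOfDegree K 0, w f = 1 := by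
    rw [monicsOfDegree_zero, sum_singleton, hone]
  have hpos : ∀ P ∈ monicIrreducibles K B, ∀ k ∈ Icc 1 B, 1 ≤ k * P.natDegree := by
    intro P hP k hk
    have h1 := (mem_monicIrreducibles.mp hP).2.2.natDegree_pos
    have h2 := (mem_Icc.mp hk).1
    exact Nat.mul_pos h2 h1
  induction s, hs using Nat.le_induction with
  | base =>
    have h := natCast_mul_sum_monicsOfDegree hone hw hB
    rw [Nat.cast_one, one_mul] at h
    rw [h, pow_one, neg_one_sq, one_mul, primePowerSum]
    refine sum_congr rfl fun P hP => sum_congr rfl fun k hk => ?_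
    have := hpos P hP k hk
    by_cases h1 : k * P.natDegree = 1
    · simp [h1, hE0]
    · rw [if_neg h1, if_neg (by omega)]
  | succ s hs ih =>
    have h := natCast_mul_sum_monicsOfDegree hone hw hB
    rw [hzero _ (by omega), mul_zero] at h
    have h2 : primePowerSum w B (s + 1) +
        primePowerSum w B s * ∑ f ∈ monicsOfDegree K 1, w f = 0 := by
      rw [h, primePowerSum, primePowerSum, sum_mul, ← sum_add_distrib]
      refine sum_congr rfl fun P hP => ?_
      rw [sum_mul, ← sum_add_distrib]
      refine sum_congr rfl fun k hk => ?_
      rcases lt_trichotomy (k * P.natDegree) s with hlt | heq | hgt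
      · rw [if_neg (by omega), if_neg (by omega), if_pos (by omega),
          hzero (s + 1 - k * P.natDegree) (by omega)]
        ring
      · rw [if_neg (by omega), if_pos heq, if_pos (by omega), heq, Nat.add_sub_cancel_left]
        ring
      · by_cases h1 : k * P.natDegree = s + 1
        · rw [if_pos h1, if_neg (by omega), if_pos (by omega), h1, Nat.sub_self, hE0]
          ring
        · rw [if_neg h1, if_neg (by omega), if_neg (by omega)]
          ring
    rw [eq_neg_of_add_eq_zero_left h2, ih (by omega)]
    ring

end MonicSums

section HasseDavenport

variable {K L R : Type*} [Field K] [Fintype K] [Field L] [Fintype L] [Algebra K L]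
  [CommRing R]

/-- The multiplicative weight of monic polynomials attached to a multiplicative and an additive
character: their values at the norm and the trace of a root. -/
noncomputable def charWeight {K R : Type*} [Field K] [CommRing R]
    (χ : MulChar K R) (ψ : AddChar K R) (f : K[X]) : R :=
  χ ((-1) ^ f.natDegree * f.coeff 0) * ψ (-f.nextCoeff)

theorem charWeight_one {K R : Type*} [Field K] [CommRing R] (χ : MulChar K R) (ψ : AddChar K R) :
    charWeight χ ψ 1 = 1 := by
  simp [charWeight, nextCoeff]

theorem charWeight_mul {K R : Type*} [Field K] [CommRing R] (χ : MulChar K R) (ψ : AddChar K R)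
    (f g : K[X]) (hf : f.Monic) (hg : g.Monic) :
    charWeight χ ψ (f * g) = charWeight χ ψ f * charWeight χ ψ g := by
  have h : (-1 : K) ^ (f.natDegree + g.natDegree) * (f.coeff 0 * g.coeff 0) =
      ((-1) ^ f.natDegree * f.coeff 0) * ((-1) ^ g.natDegree * g.coeff 0) := by ring
  rw [charWeight, hf.nextCoeff_mul hg, hf.natDegree_mul hg, mul_coeff_zero, h, map_mul, neg_add,
    AddChar.map_add_eq_mul, charWeight, charWeight]
  ring

theorem sum_charWeight_monicsOfDegree_one (χ : MulChar K R) (ψ : AddChar K R) :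
    ∑ f ∈ monicsOfDegree K 1, charWeight χ ψ f = gaussSum χ ψ := by
  rw [gaussSum]
  symm
  refine sum_bij (fun a _ => X - C a) ?_ ?_ ?_ ?_
  · intro a _
    simp [monic_X_sub_C]
  · intro a _ b _ h
    simpa using h
  · intro f hf
    rw [mem_monicsOfDegree] at hf
    refine ⟨-f.coeff 0, mem_univ _, ?_⟩
    rw [hf.1.eq_X_add_C hf.2]
    simp
  · intro a _
    simp [charWeight]

theorem sum_charWeight_eq_zero [IsDomain R] (χ : MulChar K R) {ψ : AddChar K R} (hψ : ψ ≠ 1)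
    {n : ℕ} (hn : 2 ≤ n) : ∑ f ∈ monicsOfDegree K n, charWeight χ ψ f = 0 := by
  obtain ⟨c, hc⟩ := AddChar.ne_one_iff.mp hψ
  have hdeg : ∀ (a : K), (C a * X ^ (n - 1) : K[X]).degree < n := fun a =>
    (degree_C_mul_X_pow_le _ _).trans_lt (by exact_mod_cast (by omega : n - 1 < n))
  have hmem : ∀ (a : K) (f : K[X]), f ∈ monicsOfDegree K n →
      f + C a * X ^ (n - 1) ∈ monicsOfDegree K n := by
    intro a f hf
    obtain ⟨hm, hd⟩ := mem_monicsOfDegree.mp hf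
    have hlt : (C a * X ^ (n - 1) : K[X]).degree < f.degree := by
      rw [degree_eq_natDegree hm.ne_zero, hd]
      exact hdeg a
    rw [mem_monicsOfDegree]
    exact ⟨hm.add_of_left hlt, by rw [natDegree_add_eq_left_of_degree_lt hlt, hd]⟩
  have hshift : ∑ f ∈ monicsOfDegree K n, charWeight χ ψ f =
      ψ c * ∑ f ∈ monicsOfDegree K n, charWeight χ ψ f := by
    rw [mul_sum]
    refine sum_bij' (fun f _ => f + C c * X ^ (n - 1)) (fun f _ => f + C (-c) * X ^ (n - 1))
      (fun f hf => hmem c f hf) (fun f hf => hmem (-c) f hf) ?_ ?_ ?_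
    · intro f _
      simp
    · intro f _
      simp
    · intro f hf
      have hd := (mem_monicsOfDegree.mp hf).2
      have hd' := (mem_monicsOfDegree.mp (hmem c f hf)).2
      rw [charWeight, charWeight, nextCoeff_of_natDegree_pos (by omega),
        nextCoeff_of_natDegree_pos (by omega), hd, hd', coeff_add, coeff_add, coeff_C_mul_X_pow,
        coeff_C_mul_X_pow, if_neg (by omega), if_pos rfl, add_zero, neg_add,
        AddChar.map_add_eq_mul, mul_comm (ψ (-f.coeff (n - 1))), mul_left_comm, ← mul_assoc (ψ c),
        ← AddChar.map_add_eq_mul, add_neg_cancel, AddChar.map_zero_eq_one, one_mul]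
  have h0 : (ψ c - 1) * ∑ f ∈ monicsOfDegree K n, charWeight χ ψ f = 0 := by
    rw [sub_mul, one_mul, ← hshift, sub_self]
  exact (mul_eq_zero.mp h0).resolve_left (sub_ne_zero.mpr hc)

theorem norm_eq_minpoly_coeff_zero_pow {K L : Type*} [Field K] [Field L] [Algebra K L]
    [FiniteDimensional K L] (x : L) :
    Algebra.norm K x = ((-1) ^ (minpoly K x).natDegree * (minpoly K x).coeff 0) ^
      Module.finrank (IntermediateField.adjoin K {x}) L := by
  have hx : IsIntegral K x := Algebra.IsIntegral.isIntegral x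
  have h := Algebra.PowerBasis.norm_gen_eq_coeff_zero_minpoly
    (IntermediateField.adjoin.powerBasis hx)
  rw [Algebra.norm_eq_norm_adjoin]
  rw [IntermediateField.adjoin.powerBasis_gen, IntermediateField.minpoly_gen,
    IntermediateField.adjoin.powerBasis_dim] at h
  rw [h]

theorem char_norm_mul_char_trace {K L R : Type*} [Field K] [Field L] [Algebra K L]
    [FiniteDimensional K L] [CommRing R] (χ : MulChar K R) (ψ : AddChar K R) (x : L) :
    χ (Algebra.norm K x) * ψ (Algebra.trace K L x) =
      charWeight χ ψ (minpoly K x) ^ (Module.finrank (IntermediateField.adjoin K {x}) L) := by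
  rw [norm_eq_minpoly_coeff_zero_pow, trace_eq_finrank_mul_minpoly_nextCoeff, map_pow,
    ← nsmul_eq_mul, AddChar.map_nsmul_eq_pow, ← mul_pow, charWeight]

theorem card_filter_minpoly_eq {P : K[X]} (hP : P.Monic) (hi : Irreducible P)
    (hd : P.natDegree ∣ Module.finrank K L) :
    #{x : L | minpoly K x = P} = P.natDegree := by
  have : Fact (Irreducible P) := ⟨hi⟩
  obtain ⟨φ⟩ : Nonempty (AdjoinRoot P →ₐ[K] L) :=
    FiniteField.nonempty_algHom_of_finrank_dvd (by
      rwa [(AdjoinRoot.powerBasis hi.ne_zero).finrank, AdjoinRoot.powerBasis_dim])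
  have hroot : minpoly K (φ (AdjoinRoot.root P)) = P := by
    refine (minpoly.eq_of_irreducible_of_monic hi ?_ hP).symm
    rw [aeval_algHom_apply, AdjoinRoot.aeval_eq, AdjoinRoot.mk_self, map_zero]
  have hnormal : Normal K L := inferInstance
  rw [← card_rootSet_eq_natDegree (K := L) (PerfectField.separable_of_irreducible hi)
    (hroot ▸ hnormal.splits (φ (AdjoinRoot.root P))), ← Set.toFinset_card]
  congr 1
  ext x
  rw [mem_filter, Set.mem_toFinset, mem_rootSet]
  constructor
  · rintro ⟨-, rfl⟩
    exact ⟨hi.ne_zero, minpoly.aeval K x⟩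
  · rintro ⟨-, h⟩
    exact ⟨mem_univ _, (minpoly.eq_of_irreducible_of_monic hi h hP).symm⟩

theorem natDegree_minpoly_mul_finrank {K L : Type*} [Field K] [Field L] [Algebra K L]
    [FiniteDimensional K L] (x : L) :
    Module.finrank (IntermediateField.adjoin K {x}) L * (minpoly K x).natDegree =
      Module.finrank K L := by
  rw [← IntermediateField.adjoin.finrank (Algebra.IsIntegral.isIntegral x), mul_comm,
    Module.finrank_mul_finrank]

theorem sum_char_norm_mul_char_trace (χ : MulChar K R) (ψ : AddChar K R) :
    ∑ x : L, χ (Algebra.norm K x) * ψ (Algebra.trace K L x) =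
      primePowerSum (charWeight χ ψ) (Module.finrank K L) (Module.finrank K L) := by
  have hpos : 0 < Module.finrank K L := Module.finrank_pos
  have hmaps : ∀ x ∈ (univ : Finset L),
      minpoly K x ∈ monicIrreducibles K (Module.finrank K L) := by
    intro x _
    have hx : IsIntegral K x := Algebra.IsIntegral.isIntegral x
    rw [mem_monicIrreducibles]
    exact ⟨minpoly.monic hx, minpoly.natDegree_le x, minpoly.irreducible hx⟩
  rw [primePowerSum, ← sum_fiberwise_of_maps_to hmaps]
  refine sum_congr rfl fun P hP => ?_
  obtain ⟨hm, -, hi⟩ := mem_monicIrreducibles.mp hP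
  have hdeg := hi.natDegree_pos
  by_cases hd : P.natDegree ∣ Module.finrank K L
  · obtain ⟨m, hmul⟩ := hd
    have hm1 : 1 ≤ m := Nat.pos_of_ne_zero (by rintro rfl; omega)
    have hterm : ∀ x ∈ ({x : L | minpoly K x = P} : Finset L),
        χ (Algebra.norm K x) * ψ (Algebra.trace K L x) = charWeight χ ψ P ^ m := by
      intro x hx
      obtain rfl := (mem_filter.mp hx).2
      rw [char_norm_mul_char_trace]
      have h := natDegree_minpoly_mul_finrank (K := K) x
      rw [hmul, mul_comm] at h
      rw [Nat.eq_of_mul_eq_mul_left hdeg h]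
    rw [sum_congr rfl hterm, sum_const, card_filter_minpoly_eq hm hi ⟨m, hmul⟩,
      sum_eq_single m, if_pos (by rw [hmul, mul_comm]), nsmul_eq_mul]
    · intro k _ hk
      rw [if_neg]
      intro h
      rw [hmul, mul_comm] at h
      exact hk (Nat.eq_of_mul_eq_mul_left hdeg h)
    · intro h
      refine absurd (mem_Icc.mpr ⟨hm1, ?_⟩) h
      rw [hmul]
      exact Nat.le_mul_of_pos_left m hdeg
  · rw [sum_eq_zero, sum_eq_zero]
    · intro k _
      rw [if_neg]
      rintro h
      exact hd ⟨k, by rw [← h, mul_comm]⟩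
    · intro x hx
      obtain rfl := (mem_filter.mp hx).2
      exact absurd ⟨_, by rw [← natDegree_minpoly_mul_finrank (K := K) x, mul_comm]⟩ hd

/-- The **Hasse–Davenport lifting relation** for Gauss sums. -/
theorem sum_char_norm_mul_char_trace_eq_gaussSum_pow [IsDomain R] (χ : MulChar K R)
    {ψ : AddChar K R} (hψ : ψ ≠ 1) :
    ∑ x : L, χ (Algebra.norm K x) * ψ (Algebra.trace K L x) =
      (-1) ^ (Module.finrank K L + 1) * gaussSum χ ψ ^ Module.finrank K L := by
  rw [sum_char_norm_mul_char_trace, primePowerSum_eq (charWeight_one χ ψ) (charWeight_mul χ ψ)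
    (fun n hn => sum_charWeight_eq_zero χ hψ hn) Module.finrank_pos le_rfl,
    sum_charWeight_monicsOfDegree_one]

end HasseDavenport

section CubicJacobiSum

/-- The ring of Eisenstein integers. -/
abbrev EisensteinInt : Type := QuadraticAlgebra ℤ (-1) (-1)

/-- Evaluation of Eisenstein integers at a root of `X ^ 2 + X + 1`. -/
noncomputable def eisensteinEval {A : Type*} [CommRing A] (x : A) (hx : x ^ 2 + x + 1 = 0) :
    EisensteinInt →ₐ[ℤ] A :=
  QuadraticAlgebra.lift ⟨x, by
    simp only [neg_smul, one_smul]
    linear_combination hx⟩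

theorem eisensteinEval_apply {A : Type*} [CommRing A] (x : A) (hx : x ^ 2 + x + 1 = 0)
    (z : EisensteinInt) : eisensteinEval x hx z = z.re + z.im * x := by
  simp [eisensteinEval]

theorem eisensteinEval_omega {A : Type*} [CommRing A] (x : A) (hx : x ^ 2 + x + 1 = 0) :
    eisensteinEval x hx QuadraticAlgebra.omega = x := by
  simp [eisensteinEval_apply]

theorem eisensteinInt_omega_sq_add :
    (QuadraticAlgebra.omega : EisensteinInt) ^ 2 + QuadraticAlgebra.omega + 1 = 0 := by
  rw [sq, QuadraticAlgebra.omega_mul_omega_eq_add]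
  simp only [neg_smul, one_smul]
  ring

theorem pow_three_eq_one_of_sq_add {A : Type*} [CommRing A] {x : A} (hx : x ^ 2 + x + 1 = 0) :
    x ^ 3 = 1 := by
  linear_combination (x - 1) * hx

/-- Two Eisenstein integers of the same prime norm, both congruent to `-1` modulo `3` and with
proportional residues modulo `p`, are equal. -/
theorem eisenstein_primary_unique {p : ℕ} (hp : p.Prime) {a b a₀ b₀ : ℤ}
    (h : (p : ℤ) = a ^ 2 - a * b + b ^ 2) (h₀ : (p : ℤ) = a₀ ^ 2 - a₀ * b₀ + b₀ ^ 2)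
    (ha : a % 3 = 2) (hb : b % 3 = 0) (ha₀ : a₀ % 3 = 2) (hb₀ : b₀ % 3 = 0)
    (hdvd : (p : ℤ) ∣ b * a₀ - a * b₀) : a = a₀ ∧ b = b₀ := by
  have hp' : Prime (p : ℤ) := Nat.prime_iff_prime_int.mp hp
  have hp0 : (p : ℤ) ≠ 0 := hp'.ne_zero
  obtain ⟨k, hk⟩ := hdvd
  set x := a * a₀ - a * b₀ + b * b₀ with hx
  have hnorm : x ^ 2 - x * (p * k) + (p * k) ^ 2 = p ^ 2 := by
    rw [← hk, hx]
    calc _ = (a ^ 2 - a * b + b ^ 2) * (a₀ ^ 2 - a₀ * b₀ + b₀ ^ 2) := by ring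
      _ = _ := by rw [← h, ← h₀, sq]
  have hpx : (p : ℤ) ∣ x := by
    refine hp'.dvd_of_dvd_pow (n := 2) ⟨p + x * k - p * k ^ 2, ?_⟩
    linear_combination hnorm
  obtain ⟨l, hl⟩ := hpx
  have hunit : l ^ 2 - l * k + k ^ 2 = 1 := by
    rw [hl] at hnorm
    have : (p : ℤ) ^ 2 * (l ^ 2 - l * k + k ^ 2) = p ^ 2 * 1 := by linear_combination hnorm
    exact mul_left_cancel₀ (pow_ne_zero 2 hp0) this
  have hae : a = l * a₀ - k * b₀ := by
    refine mul_left_cancel₀ hp0 ?_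
    calc (p : ℤ) * a = x * a₀ - (b * a₀ - a * b₀) * b₀ := by rw [h₀, hx]; ring
      _ = _ := by rw [hk, hl]; ring
  have hbe : b = l * b₀ + k * a₀ - k * b₀ := by
    refine mul_left_cancel₀ hp0 ?_
    calc (p : ℤ) * b = x * b₀ + (b * a₀ - a * b₀) * a₀ - (b * a₀ - a * b₀) * b₀ := by
          rw [h₀, hx]; ring
      _ = _ := by rw [hk, hl]; ring
  obtain ⟨c, rfl⟩ : ∃ c, b₀ = 3 * c := ⟨b₀ / 3, by omega⟩
  obtain ⟨d, rfl⟩ : ∃ d, a₀ = 3 * d + 2 := ⟨a₀ / 3, by omega⟩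
  have hk3 : k % 3 = 0 := by
    have : b = 3 * (l * c + k * d - k * c) + 2 * k := by rw [hbe]; ring
    omega
  have hl3 : l % 3 = 1 := by
    have : a = 3 * (l * d - k * c) + 2 * l := by rw [hae]; ring
    omega
  have hk1 : k ≤ 1 := by nlinarith [sq_nonneg (2 * l - k)]
  have hk2 : -1 ≤ k := by nlinarith [sq_nonneg (2 * l - k)]
  have hk0 : k = 0 := by omega
  subst hk0
  have hl1 : l ≤ 1 := by nlinarith
  have hl2 : -1 ≤ l := by nlinarith
  have : l = 1 := by omega
  subst this
  constructor <;> linarith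

/-- Over a finite field with more than `2 * m + 1` elements, `∑ x ^ m * (1 - x) ^ m = 0`. -/
theorem sum_pow_mul_one_sub_pow_eq_zero {K : Type*} [Field K] [Fintype K] {m : ℕ}
    (hm : 2 * m < Fintype.card K - 1) : ∑ x : K, x ^ m * (1 - x) ^ m = 0 := by
  have hdeg : (X ^ m * (1 - X) ^ m : K[X]).natDegree < Fintype.card K - 1 := by
    refine lt_of_le_of_lt ?_ hm
    have h1 : (1 - X : K[X]).natDegree ≤ 1 :=
      (natDegree_sub_le _ _).trans (by simp)
    have h2 : ((1 - X : K[X]) ^ m).natDegree ≤ m := by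
      simpa using natDegree_pow_le_of_le m h1
    have h3 := natDegree_mul_le (p := (X ^ m : K[X])) (q := (1 - X) ^ m)
    rw [natDegree_X_pow] at h3
    omega
  have heval : ∀ x : K, x ^ m * (1 - x) ^ m =
      ∑ i ∈ range (Fintype.card K - 1), (X ^ m * (1 - X) ^ m : K[X]).coeff i * x ^ i := by
    intro x
    rw [← eval_eq_sum_range' hdeg]
    simp
  rw [sum_congr rfl fun x _ => heval x, sum_comm]
  refine sum_eq_zero fun i hi => ?_
  rw [← mul_sum, FiniteField.sum_pow_lt_card_sub_one K i (mem_range.mp hi), mul_zero]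

theorem jacobiSum_inv_eq_conj {K : Type*} [Field K] [Fintype K] (χ : MulChar K ℂ) :
    jacobiSum χ⁻¹ χ⁻¹ = starRingEnd ℂ (jacobiSum χ χ) := by
  rw [← jacobiSum_ringHomComp, ← MulChar.star_eq_inv]
  rfl

theorem MulChar.pow_three_eq_one_of_generator {M R : Type*} [CommMonoid M] [CommRing R]
    {χ : MulChar M R} {g : Mˣ} (hg : ∀ x, x ∈ Subgroup.zpowers g) (h : χ g ^ 3 = 1) :
    χ ^ 3 = 1 := by
  rw [MulChar.eq_iff hg, MulChar.pow_apply_coe, h, MulChar.one_apply_coe]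

theorem MulChar.mul_self_eq_inv_of_pow_three {M R : Type*} [CommMonoid M] [CommRing R]
    {χ : MulChar M R} (h : χ ^ 3 = 1) : χ * χ = χ⁻¹ :=
  eq_inv_of_mul_eq_one_left (by rw [← h, pow_succ, sq])

theorem cubic_gaussSum_pow_three {K : Type*} [Field K] [Fintype K] {χ : MulChar K ℂ}
    (h3 : χ ^ 3 = 1) (h1 : χ ≠ 1) {ψ : AddChar K ℂ} (hψ : ψ.IsPrimitive) :
    gaussSum χ ψ ^ 3 = Fintype.card K * jacobiSum χ χ := by
  have : Fact (Nat.Prime 3) := ⟨Nat.prime_three⟩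
  have hord : orderOf χ = 3 := orderOf_eq_prime h3 h1
  have hneg : χ (-1) = 1 := by
    have hc : χ (-1) ^ 3 = 1 := by
      rw [← MulChar.pow_apply' χ (by norm_num), h3, MulChar.one_apply (by simp)]
    have hs : χ (-1) ^ 2 = 1 := by
      rw [← map_pow, neg_one_sq, map_one]
    calc χ (-1) = χ (-1) ^ 3 := by rw [pow_succ, hs, one_mul]
      _ = 1 := hc
  have h := gaussSum_pow_eq_prod_jacobiSum (χ := χ) (ψ := ψ) (by omega) hψ
  rw [hord, hneg, one_mul] at h
  simpa using h

/-- A primary prime of the Eisenstein integers is the Jacobi sum of the cubic residue character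
modulo it. -/
theorem exists_cubic_mulChar {p : ℕ} [Fact p.Prime] (hp3 : p % 3 = 1)
    {g : (ZMod p)ˣ} (hg : ∀ x, x ∈ Subgroup.zpowers g)
    {a₀ b₀ : ℤ} (hpab : (p : ℤ) = a₀ ^ 2 - a₀ * b₀ + b₀ ^ 2)
    (ha₀ : a₀ % 3 = 2) (hb₀ : b₀ % 3 = 0)
    {ω : ℂ} (hω : ω ^ 2 + ω + 1 = 0) (hconj : starRingEnd ℂ ω = ω ^ 2) (him : ω.im ≠ 0)
    {v : ZMod p} (hv : v ^ 2 + v + 1 = 0) (hπv : (a₀ : ZMod p) + b₀ * v = 0)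
    {e : ℕ} (he : (g : ZMod p) ^ ((p - 1) / 3) = v ^ e) (hu : ω ^ e ≠ 1) :
    ∃ χ : MulChar (ZMod p) ℂ, χ g = ω ^ e ∧ jacobiSum χ χ = a₀ + b₀ * ω := by
  have hp : p.Prime := Fact.out
  have hp2 := hp.two_le
  have hω3 := pow_three_eq_one_of_sq_add hω
  let ζ : EisensteinIntˣ := Units.ofPowEqOne (QuadraticAlgebra.omega : EisensteinInt) 3
    (pow_three_eq_one_of_sq_add eisensteinInt_omega_sq_add) (by norm_num)
  have hζ : ζ ^ e ∈ rootsOfUnity (Fintype.card (ZMod p)ˣ) EisensteinInt := by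
    rw [mem_rootsOfUnity, ZMod.card_units_eq_totient, Nat.totient_prime hp]
    obtain ⟨m, hm⟩ : 3 ∣ p - 1 := by omega
    rw [hm, ← pow_mul, mul_comm e, mul_assoc, pow_mul, Units.pow_ofPowEqOne, one_pow]
  let χE : MulChar (ZMod p) EisensteinInt := MulChar.ofRootOfUnity hζ hg
  have hχE : χE g = QuadraticAlgebra.omega ^ e := by
    rw [MulChar.ofRootOfUnity_spec hζ hg, Units.val_pow_eq_pow_val]
    rfl
  let toC := eisensteinEval ω hω
  let toZ := eisensteinEval v hv
  have htoC : Function.Injective toC := by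
    rw [injective_iff_map_eq_zero]
    intro z hz
    rw [eisensteinEval_apply] at hz
    have h1 := congrArg Complex.im hz
    simp only [Complex.add_im, Complex.intCast_im, Complex.mul_im, Complex.intCast_re, zero_add,
      zero_mul, add_zero, Complex.zero_im, mul_eq_zero, him, or_false, Int.cast_eq_zero] at h1
    rw [h1, Int.cast_zero, zero_mul, add_zero, Int.cast_eq_zero] at hz
    ext
    · exact hz
    · exact h1
  let χ : MulChar (ZMod p) ℂ := χE.ringHomComp toC.toRingHom
  have hχg : χ g = ω ^ e := by
    change toC (χE g) = _
    rw [hχE, map_pow, eisensteinEval_omega]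
  have hJ : jacobiSum χ χ = toC (jacobiSum χE χE) := jacobiSum_ringHomComp χE χE toC.toRingHom
  have hχ3 : χ ^ 3 = 1 := MulChar.pow_three_eq_one_of_generator hg (by
    rw [hχg, ← pow_mul, mul_comm, pow_mul, hω3, one_pow])
  have hχ1 : χ ≠ 1 := by
    intro h
    rw [h, MulChar.one_apply_coe] at hχg
    exact hu hχg.symm
  have hχχ : χ * χ ≠ 1 := by
    rw [MulChar.mul_self_eq_inv_of_pow_three hχ3]
    exact inv_ne_one.mpr hχ1
  refine ⟨χ, hχg, ?_⟩
  set J := jacobiSum χE χE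
  have hnorm : (p : ℤ) = J.re ^ 2 - J.re * J.im + J.im ^ 2 := by
    have h := jacobiSum_mul_jacobiSum_inv
      (by rw [ZMod.ringChar_zmod_n, ringChar.eq_zero]; exact hp.ne_zero.symm) hχ1 hχ1 hχχ
    rw [jacobiSum_inv_eq_conj, hJ, eisensteinEval_apply, ZMod.card] at h
    simp only [map_add, map_mul, hconj, map_intCast] at h
    have h' : (p : ℂ) = J.re ^ 2 - J.re * J.im + J.im ^ 2 := by
      linear_combination (J.re : ℂ) * J.im * hω + (J.im : ℂ) ^ 2 * hω3 - h
    exact_mod_cast h'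
  have hmod3 : J.re % 3 = 2 ∧ J.im % 3 = 0 := by
    have : Fact (Nat.Prime 3) := ⟨Nat.prime_three⟩
    have hω1 : ω ≠ 1 := fun h => him (by rw [h, Complex.one_im])
    have hprim : IsPrimitiveRoot ω 3 := by
      rw [← orderOf_eq_prime hω3 hω1]
      exact IsPrimitiveRoot.orderOf ω
    obtain ⟨z, hz, hJz⟩ := exists_jacobiSum_eq_neg_one_add (n := 3) (by norm_num) hχ3 hχ3
      (by rw [ZMod.card]; omega) hprim
    have hle : Algebra.adjoin ℤ {ω} ≤ toC.range := by
      rw [Algebra.adjoin_le_iff, Set.singleton_subset_iff]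
      exact ⟨QuadraticAlgebra.omega, eisensteinEval_omega ω hω⟩
    obtain ⟨z', rfl⟩ := hle hz
    have hJ' : J = -1 + z' * (QuadraticAlgebra.omega - 1) ^ 2 := by
      apply htoC
      rw [← hJ, hJz]
      simp only [map_add, map_neg, map_one, map_mul, map_pow, map_sub]
      rw [eisensteinEval_omega]
      rfl
    have hsq : (QuadraticAlgebra.omega - 1 : EisensteinInt) ^ 2 = -3 * QuadraticAlgebra.omega := by
      linear_combination eisensteinInt_omega_sq_add
    rw [hsq] at hJ'
    have h3 : J = -1 + (3 : ℤ) • (-z' * QuadraticAlgebra.omega) := by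
      rw [hJ', zsmul_eq_mul]
      push_cast
      ring
    constructor
    · have := congrArg QuadraticAlgebra.re h3
      simp only [QuadraticAlgebra.re_add, QuadraticAlgebra.re_neg, QuadraticAlgebra.re_one,
        QuadraticAlgebra.re_smul, smul_eq_mul] at this
      omega
    · have := congrArg QuadraticAlgebra.im h3
      simp only [QuadraticAlgebra.im_add, QuadraticAlgebra.im_neg, QuadraticAlgebra.im_one,
        QuadraticAlgebra.im_smul, smul_eq_mul] at this
      omega
  have hmodp : (J.re : ZMod p) + J.im * v = 0 := by
    have hpow : ∀ x : ZMod p, χE.ringHomComp toZ.toRingHom x = x ^ ((p - 1) / 3) := by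
      intro x
      by_cases hx : x = 0
      · rw [hx, MulChar.map_zero, zero_pow (by omega)]
      · obtain ⟨k, hk⟩ := mem_powers_iff_mem_zpowers.mpr (hg (Units.mk0 x hx))
        have hk' : (g : ZMod p) ^ k = x := by
          have := congrArg Units.val hk
          simpa using this
        have hgv : χE.ringHomComp toZ.toRingHom g = (g : ZMod p) ^ ((p - 1) / 3) := by
          change toZ (χE g) = _
          rw [hχE, map_pow, eisensteinEval_omega, he]
        rw [← hk', map_pow, hgv, ← pow_mul, ← pow_mul, mul_comm]
    have h := jacobiSum_ringHomComp χE χE toZ.toRingHom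
    rw [jacobiSum] at h
    simp only [hpow] at h
    rw [sum_pow_mul_one_sub_pow_eq_zero (by rw [ZMod.card]; omega)] at h
    rw [← eisensteinEval_apply v hv]
    exact h.symm
  have hdvd : (p : ℤ) ∣ J.im * a₀ - J.re * b₀ := by
    rw [← ZMod.intCast_zmod_eq_zero_iff_dvd]
    push_cast
    linear_combination (J.im : ZMod p) * hπv - (b₀ : ZMod p) * hmodp
  obtain ⟨h1, h2⟩ := eisenstein_primary_unique hp hnorm hpab hmod3.1 hmod3.2 ha₀ hb₀ hdvd
  rw [hJ, eisensteinEval_apply, h1, h2]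

end CubicJacobiSum

section GaussianPeriods

/-- The composition of a multiplicative character with the norm of a field extension. -/
noncomputable def MulChar.normLift {K R : Type*} [Field K] [CommRing R] (L : Type*) [Field L]
    [Algebra K L] [FiniteDimensional K L] (χ : MulChar K R) : MulChar L R where
  toMonoidHom := χ.toMonoidHom.comp (Algebra.norm K)
  map_nonunit' x hx := by
    rw [isUnit_iff_ne_zero, not_not] at hx
    change χ (Algebra.norm K x) = 0
    rw [hx, Algebra.norm_zero, MulChar.map_zero]

theorem MulChar.normLift_apply {K R L : Type*} [Field K] [CommRing R] [Field L]
    [Algebra K L] [FiniteDimensional K L] (χ : MulChar K R) (x : L) :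
    χ.normLift L x = χ (Algebra.norm K x) :=
  rfl

theorem MulChar.normLift_mul {K R L : Type*} [Field K] [CommRing R] [Field L]
    [Algebra K L] [FiniteDimensional K L] (χ φ : MulChar K R) :
    (χ * φ).normLift L = χ.normLift L * φ.normLift L := by
  ext x
  simp [MulChar.normLift_apply]

/-- Cubic Gaussian periods in terms of cubic Gauss sums. -/
theorem three_mul_sum_cubes {F : Type*} [Field F] [Fintype F] {α : Fˣ}
    (hα : ∀ x : Fˣ, x ∈ Subgroup.zpowers α) {θ : MulChar F ℂ} (h3 : θ α ^ 3 = 1) (h1 : θ α ≠ 1)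
    {ψ : AddChar F ℂ} (hψ : ψ.IsPrimitive) (c : Fˣ) :
    3 * ∑ z ∈ univ.filter (fun x : F => x ≠ 0 ∧ ∃ y : F, y ^ 3 = x), ψ (z * c) =
      θ c ^ 2 * gaussSum θ ψ + θ c * gaussSum (θ * θ) ψ - 1 := by
  have hθ3 : ∀ x : F, x ≠ 0 → θ x ^ 3 = 1 := by
    intro x hx
    rw [← MulChar.pow_apply' θ (by norm_num), MulChar.pow_three_eq_one_of_generator hα h3,
      MulChar.one_apply (isUnit_iff_ne_zero.mpr hx)]
  have hcube : ∀ x : F, x ≠ 0 → ((∃ y : F, y ^ 3 = x) ↔ θ x = 1) := by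
    intro x hx
    constructor
    · rintro ⟨y, rfl⟩
      rw [map_pow]
      exact hθ3 y (by rintro rfl; simp at hx)
    · intro h
      obtain ⟨k, hk⟩ := mem_powers_iff_mem_zpowers.mpr (hα (Units.mk0 x hx))
      have hk' : (α : F) ^ k = x := by
        have := congrArg Units.val hk
        simpa using this
      have : Fact (Nat.Prime 3) := ⟨Nat.prime_three⟩
      rw [← hk', map_pow, ← orderOf_dvd_iff_pow_eq_one, orderOf_eq_prime h3 h1] at h
      obtain ⟨j, rfl⟩ := h
      exact ⟨(α : F) ^ j, by rw [← hk', ← pow_mul, mul_comm]⟩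
  have hind : ∀ x : F, 3 * (if x ≠ 0 ∧ ∃ y : F, y ^ 3 = x then ψ (x * c) else 0) =
      ψ (x * c) + θ x * ψ (x * c) + (θ * θ) x * ψ (x * c) - if x = 0 then 1 else 0 := by
    intro x
    by_cases hx : x = 0
    · simp [hx, MulChar.map_zero]
    · rw [if_neg hx, MulChar.mul_apply]
      by_cases h : θ x = 1
      · rw [if_pos ⟨hx, (hcube x hx).mpr h⟩, h]
        ring
      · rw [if_neg fun h' => h ((hcube x hx).mp h'.2)]
        have h0 : θ x ^ 2 + θ x + 1 = 0 := by
          refine (mul_eq_zero.mp ?_).resolve_left (sub_ne_zero.mpr h)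
          linear_combination hθ3 x hx
        linear_combination (-ψ (x * c)) * h0
  have hshift : ∀ χ : MulChar F ℂ,
      ∑ x : F, χ x * ψ (x * c) = gaussSum χ (ψ.mulShift c) := by
    intro χ
    refine sum_congr rfl fun x _ => ?_
    rw [AddChar.mulShift_apply, mul_comm x]
  have hc3 := hθ3 c c.ne_zero
  have hg1 := gaussSum_mulShift θ ψ c
  have hg2 := gaussSum_mulShift (θ * θ) ψ c
  rw [MulChar.mul_apply] at hg2
  have hsum : ∑ x : F, ψ (x * c) = 0 := by
    have h := AddChar.sum_eq_zero_of_ne_one (hψ c.ne_zero)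
    simpa [AddChar.mulShift_apply, mul_comm] using h
  rw [sum_filter, mul_sum, sum_congr rfl fun x _ => hind x, sum_sub_distrib, sum_add_distrib,
    sum_add_distrib, hshift, hshift, hsum, sum_ite_eq' univ (0 : F), if_pos (mem_univ _)]
  linear_combination (-gaussSum θ (ψ.mulShift c) - gaussSum (θ * θ) (ψ.mulShift c)) * hc3 +
    θ c ^ 2 * hg1 + θ c * hg2

/-- The trace lift of a nontrivial additive character is primitive. -/
theorem isPrimitive_comp_trace {K L : Type*} [Field K] [Field L] [Algebra K L]
    [FiniteDimensional K L] [Algebra.IsSeparable K L] {ψ : AddChar K ℂ} (hψ : ψ ≠ 1) :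
    (ψ.compAddMonoidHom (Algebra.trace K L).toAddMonoidHom).IsPrimitive := by
  refine AddChar.IsPrimitive.of_ne_one ?_
  obtain ⟨c, hc⟩ := AddChar.ne_one_iff.mp hψ
  obtain ⟨x, hx⟩ := Algebra.trace_surjective K L c
  refine AddChar.ne_one_iff.mpr ⟨x, ?_⟩
  rw [AddChar.compAddMonoidHom_apply]
  change ψ (Algebra.trace K L x) ≠ 1
  rwa [hx]

/-- The lifted cubic Gauss sum, in terms of the Jacobi sum over the base field. -/
theorem gaussSum_normLift_cubic {K L : Type*} [Field K] [Fintype K] [Field L] [Fintype L]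
    [Algebra K L] {χ : MulChar K ℂ} (h3 : χ ^ 3 = 1) (h1 : χ ≠ 1)
    {ψ : AddChar K ℂ} (hψ : ψ.IsPrimitive) (hψ1 : ψ ≠ 1) {s : ℕ}
    (hs : Module.finrank K L = 3 * s) :
    gaussSum (χ.normLift L) (ψ.compAddMonoidHom (Algebra.trace K L).toAddMonoidHom) =
      (-1) ^ (3 * s + 1) * (Fintype.card K : ℂ) ^ s * jacobiSum χ χ ^ s := by
  have h := sum_char_norm_mul_char_trace_eq_gaussSum_pow (L := L) χ hψ1
  rw [hs, pow_mul, cubic_gaussSum_pow_three h3 h1 hψ, mul_pow, ← mul_assoc] at h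
  exact h

end GaussianPeriods

/-- Explicit values of the three Gaussian periods `η_1, η_α, η_{α²}` for
`p ≡ 1 (mod 3)`, `3 ∣ t`, `r = p^t`. -/
theorem stmt_11 (p t : ℕ) (hp : p.Prime) (hp3 : p % 3 = 1) (ht : 1 ≤ t) (ht3 : 3 ∣ t)
    (r : ℕ) (hr : r = p ^ t)
    (F : Type) [Field F] [Fintype F] [Algebra (ZMod p) F]
    (hcardF : Fintype.card F = r)
    (α : Fˣ) (hα : ∀ x : Fˣ, x ∈ Subgroup.zpowers α)
    (ψ : F → ℂ)
    (hψ : ∀ x : F, ψ x = Complex.exp (2 * Real.pi * Complex.I *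
      (ZMod.val (Algebra.trace (ZMod p) F x)) / p))
    (η : F → ℂ)
    (hη : ∀ u : F, η u =
      ∑ z ∈ Finset.univ.filter (fun x : F => x ≠ 0 ∧ ∃ y : F, y ^ 3 = x), ψ (z * u))
    (a₀ b₀ : ℤ) (hpab : (p : ℤ) = a₀ ^ 2 - a₀ * b₀ + b₀ ^ 2)
    (ha₀ : a₀ % 3 = 2) (hb₀ : b₀ % 3 = 0) (hb₀pos : 0 < b₀)
    (ω πc : ℂ) (hω : ω = (-1 + Complex.I * Real.sqrt 3) / 2)
    (hπ : πc = (a₀ : ℂ) + (b₀ : ℂ) * ω)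
    (b' : ℤ) (hb' : (b₀ * b') % p = 1)
    (uα : ℂ)
    (huα₁ : ((α : F) ^ ((r - 1) / (p - 1))) ^ ((p - 1) / 3) =
      algebraMap (ZMod p) F ((-(b' * a₀) : ℤ) : ZMod p) → uα = ω)
    (huα₂ : ((α : F) ^ ((r - 1) / (p - 1))) ^ ((p - 1) / 3) =
      algebraMap (ZMod p) F ((-1 + b' * a₀ : ℤ) : ZMod p) → uα = ω ^ 2) :
    η 1 = ((-1 : ℂ) ^ (t + 1) * (p : ℂ) ^ (t / 3) *
        (πc ^ (t / 3) + (starRingEnd ℂ πc) ^ (t / 3)) - 1) / 3 ∧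
    η (α : F) = ((-1 : ℂ) ^ (t + 1) * (p : ℂ) ^ (t / 3) *
        (uα ^ 2 * πc ^ (t / 3) + uα * (starRingEnd ℂ πc) ^ (t / 3)) - 1) / 3 ∧
    η ((α : F) ^ 2) = ((-1 : ℂ) ^ (t + 1) * (p : ℂ) ^ (t / 3) *
        (uα * πc ^ (t / 3) + uα ^ 2 * (starRingEnd ℂ πc) ^ (t / 3)) - 1) / 3 := by
  have : Fact p.Prime := ⟨hp⟩
  have hp2 := hp.two_le
  obtain ⟨s, rfl⟩ := ht3
  have hs3 : 3 * s / 3 = s := by omega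
  have hfin : Module.finrank (ZMod p) F = 3 * s := by
    have h := Module.card_eq_pow_finrank (K := ZMod p) (V := F)
    rw [hcardF, hr, ZMod.card] at h
    exact (Nat.pow_right_injective hp2 h).symm
  have hωim : ω.im ≠ 0 := by
    rw [hω]
    simp
  have hsq3 : ((Real.sqrt 3 : ℝ) : ℂ) ^ 2 = 3 := by
    rw [← Complex.ofReal_pow, Real.sq_sqrt (by norm_num)]
    norm_num
  have hω0 : ω ^ 2 + ω + 1 = 0 := by
    rw [hω]
    linear_combination (Complex.I ^ 2 / 4) * hsq3 + (3 / 4) * Complex.I_sq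
  have hω3 := pow_three_eq_one_of_sq_add hω0
  have hωconj : starRingEnd ℂ ω = ω ^ 2 := by
    have h : starRingEnd ℂ ω = -1 - ω := by
      rw [hω]
      simp only [map_div₀, map_add, map_neg, map_one, map_mul, Complex.conj_I,
        Complex.conj_ofReal, map_ofNat]
      ring
    rw [h]
    linear_combination -hω0
  have hω1 : ω ≠ 1 := fun h => hωim (by rw [h, Complex.one_im])
  let g : (ZMod p)ˣ := Units.map (Algebra.norm (ZMod p)) α
  have hgα : (g : ZMod p) = Algebra.norm (ZMod p) (α : F) := rfl
  have hg : ∀ x, x ∈ Subgroup.zpowers g := by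
    intro x
    obtain ⟨y, rfl⟩ := FiniteField.unitsMap_norm_surjective (ZMod p) F x
    obtain ⟨k, rfl⟩ := hα y
    exact ⟨k, (map_zpow _ _ _).symm⟩
  have hnorm : (α : F) ^ ((r - 1) / (p - 1)) = algebraMap (ZMod p) F g := by
    rw [hgα, FiniteField.algebraMap_norm_eq_pow, Nat.card_eq_fintype_card, hcardF, Nat.card_zmod]
  set v : ZMod p := ((-(b' * a₀) : ℤ) : ZMod p) with hv
  have hbb : (b₀ : ZMod p) * b' = 1 := by
    have h : ((b₀ * b' : ℤ) : ZMod p) = ((1 : ℤ) : ZMod p) := by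
      rw [ZMod.intCast_eq_intCast_iff, Int.ModEq, hb']
      exact (Int.emod_eq_of_lt (by norm_num) (by exact_mod_cast hp2)).symm
    exact_mod_cast h
  have hpab' : (a₀ : ZMod p) ^ 2 - a₀ * b₀ + b₀ ^ 2 = 0 := by
    have h := congrArg (Int.cast : ℤ → ZMod p) hpab
    push_cast at h
    rw [← h, ZMod.natCast_self]
  have hπv : (a₀ : ZMod p) + b₀ * v = 0 := by
    rw [hv]
    push_cast
    linear_combination (-(a₀ : ZMod p)) * hbb
  have hv0 : v ^ 2 + v + 1 = 0 := by
    rw [hv]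
    push_cast
    linear_combination (b' : ZMod p) ^ 2 * hpab' +
      ((a₀ : ZMod p) * b' - b₀ * b' - 1) * hbb
  have hgm : ((g : ZMod p) ^ ((p - 1) / 3)) ^ 2 + (g : ZMod p) ^ ((p - 1) / 3) + 1 = 0 := by
    have hm : (p - 1) / 3 * 3 = p - 1 := by omega
    have hcube : ((g : ZMod p) ^ ((p - 1) / 3)) ^ 3 = 1 := by
      rw [← pow_mul, hm]
      exact ZMod.pow_card_sub_one_eq_one g.ne_zero
    have hne : (g : ZMod p) ^ ((p - 1) / 3) ≠ 1 := by
      intro h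
      have hord : orderOf g = p - 1 := by
        rw [orderOf_eq_card_of_forall_mem_zpowers hg, Nat.card_eq_fintype_card,
          ZMod.card_units]
      have hdvd : orderOf g ∣ (p - 1) / 3 :=
        orderOf_dvd_of_pow_eq_one (Units.ext (by simpa using h))
      have := Nat.le_of_dvd (by omega) hdvd
      omega
    refine (mul_eq_zero.mp ?_).resolve_left (sub_ne_zero.mpr hne)
    linear_combination hcube
  have hcases : ∃ e : ℕ, (g : ZMod p) ^ ((p - 1) / 3) = v ^ e ∧ uα = ω ^ e ∧ ω ^ e ≠ 1 := by
    have hprod : ((g : ZMod p) ^ ((p - 1) / 3) - v) *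
        ((g : ZMod p) ^ ((p - 1) / 3) - (-1 - v)) = 0 := by
      linear_combination hgm - hv0
    rcases mul_eq_zero.mp hprod with h | h
    · refine ⟨1, by rw [pow_one, sub_eq_zero.mp h], ?_, by rwa [pow_one]⟩
      rw [pow_one]
      apply huα₁
      rw [hnorm, ← map_pow, sub_eq_zero.mp h]
    · refine ⟨2, ?_, ?_, ?_⟩
      · linear_combination h - hv0
      · apply huα₂
        rw [hnorm, ← map_pow, sub_eq_zero.mp h, hv]
        push_cast
        ring_nf
      · intro h2
        apply hω1
        linear_combination hω3 - ω * h2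
  obtain ⟨e, he, huα, hu1⟩ := hcases
  obtain ⟨χ, hχg, hJ⟩ := exists_cubic_mulChar hp3 hg hpab ha₀ hb₀ hω0 hωconj hωim hv0 hπv he hu1
  rw [← huα] at hχg hu1
  rw [← hπ] at hJ
  have huα3 : uα ^ 3 = 1 := by
    rw [huα, ← pow_mul, mul_comm, pow_mul, hω3, one_pow]
  have hχ3 : χ ^ 3 = 1 := MulChar.pow_three_eq_one_of_generator hg (by rw [hχg, huα3])
  have hχ1 : χ ≠ 1 := by
    rintro rfl
    rw [MulChar.one_apply_coe] at hχg
    exact hu1 hχg.symm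
  have hψp := ZMod.isPrimitive_stdAddChar p
  have hψ1 : (ZMod.stdAddChar : AddChar (ZMod p) ℂ) ≠ 1 := by
    have h := hψp one_ne_zero
    rwa [AddChar.mulShift_one] at h
  have hG1 := gaussSum_normLift_cubic hχ3 hχ1 hψp hψ1 hfin
  have hG2 := gaussSum_normLift_cubic (χ := χ * χ)
    (by rw [mul_pow, hχ3, one_mul])
    (by rw [MulChar.mul_self_eq_inv_of_pow_three hχ3]; exact inv_ne_one.mpr hχ1) hψp hψ1 hfin
  rw [MulChar.normLift_mul, MulChar.mul_self_eq_inv_of_pow_three hχ3, jacobiSum_inv_eq_conj,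
    hJ, ZMod.card] at hG2
  rw [hJ, ZMod.card] at hG1
  have hθα : χ.normLift F α = uα := hχg
  have hperiod : ∀ c : Fˣ, η c = ((χ.normLift F c) ^ 2 *
      ((-1) ^ (3 * s + 1) * (p : ℂ) ^ s * πc ^ s) + χ.normLift F c *
      ((-1) ^ (3 * s + 1) * (p : ℂ) ^ s * starRingEnd ℂ πc ^ s) - 1) / 3 := by
    intro c
    have h := three_mul_sum_cubes hα (θ := χ.normLift F) (by rw [hθα, huα3]) (by rwa [hθα])
      (isPrimitive_comp_trace (L := F) hψ1) c
    rw [hG1, hG2] at h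
    rw [← h, hη, mul_div_cancel_left₀ _ (by norm_num)]
    refine sum_congr rfl fun z _ => ?_
    rw [hψ, AddChar.compAddMonoidHom_apply]
    change _ = ZMod.stdAddChar (Algebra.trace (ZMod p) F (z * c))
    rw [ZMod.stdAddChar_apply, ZMod.toCircle_apply]
  rw [hs3]
  refine ⟨?_, ?_, ?_⟩
  · have h := hperiod 1
    rw [Units.val_one, map_one] at h
    rw [h]
    ring
  · rw [hperiod, hθα]
    ring
  · have h := hperiod (α ^ 2)
    rw [Units.val_pow_eq_pow_val, map_pow, hθα] at h
    rw [h]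
    linear_combination ((-1 : ℂ) ^ (3 * s + 1) * (p : ℂ) ^ s * πc ^ s * uα / 3) * huα3
end

section
/- Let r = 2^t with t an even positive integer and let c ∈ GF(r)^*. Then the number of pairs (y, b) ∈ GF(r)² satisfying y³ = c·b·(b+1) equals r + Σ_{y ∈ GF(r)} ψ(c^{−1} y³), which in turn equals r + 1 + 3·η_{c²}^{(3,r)}. -/
open scoped Classical

/-- Additive Hilbert 90 over the prime field of characteristic two: an element is of the form
`b² + b` exactly when its absolute trace vanishes. -/
theorem exists_sq_add_self_eq_iff_trace_eq_zero {F : Type*} [Field F] [Fintype F]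
    [Algebra (ZMod 2) F] (a : F) :
    (∃ b : F, b ^ 2 + b = a) ↔ Algebra.trace (ZMod 2) F a = 0 := by
  have : CharP F 2 := charP_of_injective_algebraMap (algebraMap (ZMod 2) F).injective 2
  let φ : F ≃ₐ[ZMod 2] F := FiniteField.frobeniusAlgEquivOfAlgebraic (ZMod 2) F
  have hφ (x : F) : φ x = x ^ 2 := by
    simp [φ]
  let P : F →ₗ[ZMod 2] F := φ.toLinearMap + LinearMap.id
  have hP (x : F) : P x = x ^ 2 + x := by simp [P, hφ]
  let T := Algebra.trace (ZMod 2) F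
  have hle : LinearMap.range P ≤ LinearMap.ker T := by
    rintro _ ⟨b, rfl⟩
    rw [LinearMap.mem_ker, hP, map_add, ← hφ, Algebra.trace_eq_of_algEquiv]
    exact CharTwo.add_self_eq_zero _
  have hker : LinearMap.ker P ≤ Submodule.span (ZMod 2) {(1 : F)} := by
    intro x hx
    rw [LinearMap.mem_ker, hP] at hx
    have hx' : x * (x + 1) = 0 := by linear_combination hx
    rcases mul_eq_zero.mp hx' with rfl | h
    · exact zero_mem _
    · rw [CharTwo.add_eq_zero.mp h]
      exact Submodule.mem_span_singleton_self _
  have hkerP : Module.finrank (ZMod 2) (LinearMap.ker P) ≤ 1 :=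
    (Submodule.finrank_mono hker).trans (finrank_span_singleton one_ne_zero).le
  have hrange : Module.finrank (ZMod 2) (LinearMap.range T) = 1 := by
    rw [LinearMap.range_eq_top.mpr (Algebra.trace_surjective (ZMod 2) F), finrank_top,
      Module.finrank_self]
  have h₁ := P.finrank_range_add_finrank_ker
  have h₂ := T.finrank_range_add_finrank_ker
  have heq := Submodule.eq_of_le_of_finrank_le hle (by omega)
  have hmem : a ∈ LinearMap.range P ↔ a ∈ LinearMap.ker T := by rw [heq]
  simpa [hP, T] using hmem

/-- The number of solutions of `b² + b = a` in a finite field of characteristic two. -/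
theorem card_filter_sq_add_self_eq {F : Type*} [Field F] [Fintype F] [Algebra (ZMod 2) F]
    (a : F) :
    ((Finset.univ.filter fun b : F => b ^ 2 + b = a).card : ℂ) =
      1 + (-1 : ℂ) ^ (ZMod.val (Algebra.trace (ZMod 2) F a)) := by
  have : CharP F 2 := charP_of_injective_algebraMap (algebraMap (ZMod 2) F).injective 2
  by_cases h : ∃ b : F, b ^ 2 + b = a
  · rw [(exists_sq_add_self_eq_iff_trace_eq_zero a).mp h]
    obtain ⟨b, rfl⟩ := h
    have hset : (Finset.univ.filter fun x : F => x ^ 2 + x = b ^ 2 + b) = {b, b + 1} := by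
      ext x
      simp only [Finset.mem_filter, Finset.mem_univ, true_and, Finset.mem_insert,
        Finset.mem_singleton]
      have h2 : (2 : F) = 0 := CharTwo.two_eq_zero
      constructor
      · intro hx
        have hx' : (x - b) * (x - (b + 1)) = 0 := by
          linear_combination hx + (b ^ 2 - x * b - x + b) * h2
        rcases mul_eq_zero.mp hx' with h | h
        · exact .inl (sub_eq_zero.mp h)
        · exact .inr (sub_eq_zero.mp h)
      · rintro (rfl | rfl)
        · rfl
        · linear_combination (b + 1) * h2
    rw [hset, Finset.card_pair (by simp)]
    norm_num
  · have htr : Algebra.trace (ZMod 2) F a = 1 := by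
      have hne := mt (exists_sq_add_self_eq_iff_trace_eq_zero a).mpr h
      generalize Algebra.trace (ZMod 2) F a = s at hne
      fin_cases s
      · exact absurd rfl hne
      · rfl
    push Not at h
    rw [htr, Finset.filter_false_of_mem fun b _ => h b, ZMod.val_one]
    norm_num

/-- A finite field whose multiplicative group has order divisible by three contains
a nontrivial cube root of unity. -/
theorem exists_sq_add_self_add_one_eq_zero {F : Type*} [Field F] [Fintype F]
    (h : 3 ∣ Fintype.card F - 1) : ∃ w : F, w ≠ 1 ∧ w ^ 2 + w + 1 = 0 := by
  have : Fact (Nat.Prime 3) := ⟨Nat.prime_three⟩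
  obtain ⟨u, hu⟩ := exists_prime_orderOf_dvd_card (G := Fˣ) 3 (by rwa [Fintype.card_units])
  have h1 : (u : F) ≠ 1 := by
    intro h1
    rw [Units.val_eq_one.mp h1, orderOf_one] at hu
    omega
  have h3 : (u : F) ^ 3 = 1 := by
    rw [← Units.val_pow_eq_pow_val, ← hu, pow_orderOf_eq_one, Units.val_one]
  refine ⟨u, h1, (mul_eq_zero.mp ?_).resolve_left (sub_ne_zero.mpr h1)⟩
  linear_combination h3

/-- In the presence of a nontrivial cube root of unity, every nonzero cube has exactly three
cube roots. -/
theorem card_filter_cube_eq_cube {F : Type*} [Field F] [Fintype F] {w : F} (hw1 : w ≠ 1)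
    (hw : w ^ 2 + w + 1 = 0) {x : F} (hx : x ≠ 0) :
    (Finset.univ.filter fun y : F => y ^ 3 = x ^ 3).card = 3 := by
  have hw0 : w ≠ 0 := by
    rintro rfl
    simp at hw
  have hset : (Finset.univ.filter fun y : F => y ^ 3 = x ^ 3) = {x, w * x, w ^ 2 * x} := by
    ext y
    simp only [Finset.mem_filter, Finset.mem_univ, true_and, Finset.mem_insert,
      Finset.mem_singleton]
    constructor
    · intro hy
      have hy' : (y - x) * ((y - w * x) * (y - w ^ 2 * x)) = 0 := by
        linear_combination hy + (y - x) * (x ^ 2 * (w - 1) - x * y) * hw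
      simpa only [mul_eq_zero, sub_eq_zero] using hy'
    · rintro (rfl | rfl | rfl)
      · rfl
      · linear_combination x ^ 3 * (w - 1) * hw
      · linear_combination x ^ 3 * (w - 1) * (w ^ 3 + 1) * hw
  rw [hset, Finset.card_eq_three]
  refine ⟨x, w * x, w ^ 2 * x, ?_, ?_, ?_, rfl⟩
  · intro h
    exact hw1 (mul_right_cancel₀ hx (by linear_combination -h))
  · intro h
    exact hw1 (mul_right_cancel₀ hx (by linear_combination w * h + x * (w - 1) * hw))
  · intro h
    exact hw1 (mul_left_cancel₀ (mul_ne_zero hw0 hx) (by linear_combination -h))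

/-- A sum over cubes, expressed through the sum over the set of nonzero cubes. -/
theorem sum_cube_eq_add_three_mul_sum {F : Type*} [Field F] [Fintype F]
    (h : 3 ∣ Fintype.card F - 1) (f : F → ℂ) :
    ∑ y : F, f (y ^ 3) =
      f 0 + 3 * ∑ z ∈ Finset.univ.filter (fun x : F => x ≠ 0 ∧ ∃ y : F, y ^ 3 = x), f z := by
  obtain ⟨w, hw1, hw⟩ := exists_sq_add_self_add_one_eq_zero h
  rw [← Finset.add_sum_erase _ _ (Finset.mem_univ (0 : F)), zero_pow three_ne_zero,
    Finset.mul_sum]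
  congr 1
  rw [← Finset.sum_fiberwise_of_maps_to (g := fun y : F => y ^ 3)
    (t := Finset.univ.filter (fun x : F => x ≠ 0 ∧ ∃ y : F, y ^ 3 = x))]
  · refine Finset.sum_congr rfl fun z hz => ?_
    obtain ⟨hz0, x, rfl⟩ := (Finset.mem_filter.mp hz).2
    have hx : x ≠ 0 := fun hx => hz0 (by rw [hx, zero_pow three_ne_zero])
    have hfib : ((Finset.univ.erase (0 : F)).filter fun y => y ^ 3 = x ^ 3) =
        Finset.univ.filter fun y => y ^ 3 = x ^ 3 := by
      ext y
      simp only [Finset.mem_filter, Finset.mem_erase, Finset.mem_univ, and_true, true_and,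
        and_iff_right_iff_imp]
      rintro hy rfl
      exact hz0 (by rw [← hy, zero_pow three_ne_zero])
    rw [hfib, Finset.sum_congr rfl (g := fun _ => f (x ^ 3))
      fun y hy => by rw [(Finset.mem_filter.mp hy).2], Finset.sum_const,
      card_filter_cube_eq_cube hw1 hw hx, nsmul_eq_mul]
    norm_num
  · intro y hy
    simpa using hy

/-- Point count of the curve `y³ = c·b·(b+1)` over `GF(2^t)`, `t` even, in
terms of the Gaussian period `η_{c²}^{(3,r)}`. -/
theorem stmt_14 (t : ℕ) (ht : 0 < t) (hte : Even t)
    (r : ℕ) (hr : r = 2 ^ t)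
    (F : Type) [Field F] [Fintype F] [Algebra (ZMod 2) F]
    (hcardF : Fintype.card F = r)
    (ψ : F → ℂ)
    (hψ : ∀ x : F, ψ x = (-1 : ℂ) ^ (ZMod.val (Algebra.trace (ZMod 2) F x)))
    (η : F → ℂ)
    (hη : ∀ u : F, η u =
      ∑ z ∈ Finset.univ.filter (fun x : F => x ≠ 0 ∧ ∃ y : F, y ^ 3 = x), ψ (z * u))
    (c : F) (hc : c ≠ 0) :
    (Set.ncard {yb : F × F | yb.1 ^ 3 = c * yb.2 * (yb.2 + 1)} : ℂ) =
        (r : ℂ) + ∑ y : F, ψ (c⁻¹ * y ^ 3) ∧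
    (r : ℂ) + (∑ y : F, ψ (c⁻¹ * y ^ 3)) =
        (r : ℂ) + 1 + 3 * η (c ^ 2) := by
  constructor
  · have hset : {yb : F × F | yb.1 ^ 3 = c * yb.2 * (yb.2 + 1)} =
        ((Finset.univ.filter fun yb : F × F => yb.2 ^ 2 + yb.2 = c⁻¹ * yb.1 ^ 3 :
          Finset (F × F)) : Set (F × F)) := by
      ext ⟨y, b⟩
      simp only [Set.mem_ofPred_eq, Finset.coe_filter, Finset.mem_univ, true_and]
      rw [eq_inv_mul_iff_mul_eq₀ hc, eq_comm]
      ring_nf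
    rw [hset, Set.ncard_coe_finset, Finset.card_filter, Fintype.sum_prod_type, Nat.cast_sum]
    simp only [← Finset.card_filter, card_filter_sq_add_self_eq, ← hψ]
    rw [Finset.sum_add_distrib, Finset.sum_const, Finset.card_univ, hcardF, nsmul_one]
  · have h3 : 3 ∣ Fintype.card F - 1 := by
      obtain ⟨k, rfl⟩ := hte
      rw [hcardF, hr, ← two_mul, pow_mul]
      simpa only [one_pow, Nat.reducePow, Nat.reduceSub] using Nat.sub_dvd_pow_sub_pow 4 1 k
    have hsub : ∑ y : F, ψ (c⁻¹ * y ^ 3) = ∑ y : F, ψ (y ^ 3 * c ^ 2) := by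
      refine (Fintype.sum_equiv (Equiv.mulLeft₀ c hc) _ _ fun y => ?_).symm
      congr 1
      simp only [Equiv.mulLeft₀_apply]
      field_simp
    rw [hsub, sum_cube_eq_add_three_mul_sum h3 fun z => ψ (z * c ^ 2), hη, add_assoc]
    simp [hψ 0]
end

section
/- Assume e = N = 3 and p is odd. For c₁, c₂, c₃ ∈ GF(r)^*, let F(c₁,c₂,c₃) = {(a,b) ∈ GF(r)² : (a + β^i b)·g^i·c_i ∈ C^{(3,r)} for i = 1, 2, 3} and f(c₁,c₂,c₃) = #F(c₁,c₂,c₃). Let ρ be any multiplicative character of GF(r) of order 3, χ the quadratic character of GF(r), J(χ',χ') = Σ_{x ∈ GF(r)} χ'(x)χ'(1−x) the Jacobi sum, and δ₃(x) = 1 if x ∈ C^{(3,r)} and δ₃(x) = 0 otherwise. Then f(c₁,c₂,c₃) = ((r−1)/27)·( r + 1 − 3δ₃(g² c₂ c₃^{−1}) − 3δ₃(g c₁ c₃^{−1}) − 3δ₃(g² c₁ c₂^{−1}) + χ(−3)·( ρ(c₁c₂c₃)·J(ρ,ρ) + ρ²(c₁c₂c₃)·J(ρ²,ρ²) ) ).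 -/
open scoped Classical

/-- The sum `∑ A(u) B(v) D(u + v)` over a finite field factors through a Jacobi sum. -/
theorem MulChar.sum_sum_mul_mul_add {F : Type*} [Field F] [Fintype F] (A B D : MulChar F ℂ) :
    ∑ uv : F × F, A uv.1 * B uv.2 * D (uv.1 + uv.2) =
      (∑ t : F, (A * B * D) t) * jacobiSum A B := by
  have key (t : F) : ∑ u : F, A u * B (t - u) * D t = (A * B * D) t * jacobiSum A B := by
    rcases eq_or_ne t 0 with rfl | ht
    · simp
    rw [jacobiSum, Finset.mul_sum, ← Equiv.sum_comp (Equiv.mulLeft₀ t ht)]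
    refine Finset.sum_congr rfl fun x _ => ?_
    have hx : t - t * x = t * (1 - x) := by ring
    simp only [Equiv.mulLeft₀_apply, hx, map_mul, MulChar.mul_apply]
    ring
  rw [Finset.sum_mul, ← Finset.sum_congr rfl fun t _ => key t, Finset.sum_comm,
    Fintype.sum_prod_type]
  refine Finset.sum_congr rfl fun u _ => ?_
  rw [← Equiv.sum_comp (Equiv.addLeft u) fun t => A u * B (t - u) * D t]
  simp

section CubicCharacter

variable {F : Type*} [Field F] {ρ : MulChar F ℂ}

theorem cubicChar_pow_three (hρ : orderOf ρ = 3) : ρ ^ 3 = 1 := hρ ▸ pow_orderOf_eq_one ρ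

theorem cubicChar_apply_pow_three (hρ : orderOf ρ = 3) {x : F} (hx : x ≠ 0) : ρ x ^ 3 = 1 := by
  rw [← MulChar.pow_apply' ρ three_ne_zero, cubicChar_pow_three hρ,
    MulChar.one_apply (isUnit_iff_ne_zero.mpr hx)]

theorem cubicChar_apply_cube (hρ : orderOf ρ = 3) {x : F} (hx : x ≠ 0) : ρ (x ^ 3) = 1 := by
  rw [map_pow, cubicChar_apply_pow_three hρ hx]

theorem cubicChar_apply_eq_one_iff [Finite F] (hρ : orderOf ρ = 3) {x : F} (hx : x ≠ 0) :
    ρ x = 1 ↔ ∃ y : F, y ^ 3 = x := by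
  constructor
  · intro h
    obtain ⟨α, hα⟩ := IsCyclic.exists_generator (α := Fˣ)
    obtain ⟨k, hk⟩ := Subgroup.mem_zpowers_iff.mp (hα (Units.mk0 x hx))
    have hxk : x = ((α ^ k : Fˣ) : F) := by rw [hk, Units.val_mk0]
    have hord : orderOf (MulChar.toUnitHom ρ α) = 3 := by
      refine orderOf_eq_prime ?_ fun h1 => ?_
      · ext
        simpa using cubicChar_apply_pow_three hρ α.ne_zero
      · have : ρ = 1 := by
          ext a
          obtain ⟨n, rfl⟩ := Subgroup.mem_zpowers_iff.mp (hα a)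
          rw [← MulChar.coe_toUnitHom, map_zpow, h1, one_zpow, Units.val_one,
            MulChar.one_apply (Units.isUnit _)]
        rw [this, orderOf_one] at hρ
        omega
    have h3 : (3 : ℤ) ∣ k := by
      have h2 : MulChar.toUnitHom ρ α ^ k = 1 := by
        rw [← map_zpow]
        ext
        rw [MulChar.coe_toUnitHom, ← hxk, h, Units.val_one]
      have := orderOf_dvd_iff_zpow_eq_one.mpr h2
      rwa [hord] at this
    obtain ⟨j, rfl⟩ := h3
    exact ⟨((α ^ j : Fˣ) : F), by
      rw [hxk, ← Units.val_pow_eq_pow_val, ← zpow_natCast, ← zpow_mul, mul_comm j]; rfl⟩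
  · rintro ⟨y, rfl⟩
    exact cubicChar_apply_cube hρ (by rintro rfl; simp at hx)

/-- The indicator of the nonzero cubes in terms of a cubic character. -/
theorem indicator_cubes_eq [Finite F] (hρ : orderOf ρ = 3) (x : F) :
    (if x ≠ 0 ∧ ∃ y : F, y ^ 3 = x then (1 : ℂ) else 0) =
      (∑ i ∈ Finset.range 3, (ρ ^ i) x) / 3 := by
  rcases eq_or_ne x 0 with rfl | hx
  · simp [MulChar.map_zero]
  have h1 : (1 : MulChar F ℂ) x = 1 := MulChar.one_apply (isUnit_iff_ne_zero.mpr hx)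
  have h3 := cubicChar_apply_pow_three hρ hx
  simp only [Finset.sum_range_succ, Finset.sum_range_zero, zero_add, pow_zero, pow_one, h1,
    MulChar.pow_apply' ρ two_ne_zero, ← cubicChar_apply_eq_one_iff hρ hx, hx, ne_eq,
    not_false_eq_true, true_and]
  split_ifs with h
  · rw [h]; norm_num
  · have : (ρ x - 1) * (1 + ρ x + ρ x ^ 2) = 0 := by linear_combination h3
    rw [(mul_eq_zero.mp this).resolve_left (sub_ne_zero.mpr h), zero_div]

theorem sum_cubicChar_pow [Fintype F] (hρ : orderOf ρ = 3) (n : ℕ) :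
    ∑ t : F, (ρ ^ n) t = if 3 ∣ n then (Fintype.card F : ℂ) - 1 else 0 := by
  split_ifs with h
  · rw [orderOf_dvd_iff_pow_eq_one.mp (hρ ▸ h), MulChar.sum_one_eq_card_units,
      Fintype.card_units, Nat.cast_sub Fintype.card_pos, Nat.cast_one]
  · exact MulChar.sum_eq_zero_of_ne_one fun h1 => h (hρ ▸ orderOf_dvd_iff_pow_eq_one.mpr h1)

/-- Number of `(u, v)` with `d₁ u`, `d₂ v`, `d₃ (u + v)` all nonzero cubes, expressed through
the values and Jacobi sums of a cubic character. -/
theorem sum_indicator_cubes [Fintype F] (hρ : orderOf ρ = 3) {I : F → ℂ}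
    (hI : ∀ x, I x = (∑ i ∈ Finset.range 3, (ρ ^ i) x) / 3)
    {d₁ d₂ d₃ : F} (h₁ : d₁ ≠ 0) (h₂ : d₂ ≠ 0) (h₃ : d₃ ≠ 0) :
    ∑ uv : F × F, I (uv.1 * d₁) * I (uv.2 * d₂) * I ((uv.1 + uv.2) * d₃) =
      ((Fintype.card F : ℂ) - 1) / 27 * ((Fintype.card F : ℂ) + 1 - 3 * I (d₂ * d₃⁻¹)
        - 3 * I (d₁ * d₃⁻¹) - 3 * I (d₁ * d₂⁻¹)
        + (ρ (d₁ * d₂ * d₃) * jacobiSum ρ ρ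
          + (ρ ^ 2) (d₁ * d₂ * d₃) * jacobiSum (ρ ^ 2) (ρ ^ 2))) := by
  have hT (i j k : ℕ) : ∑ uv : F × F, (ρ ^ i) uv.1 * (ρ ^ j) uv.2 * (ρ ^ k) (uv.1 + uv.2) =
      (if 3 ∣ i + j + k then (Fintype.card F : ℂ) - 1 else 0) * jacobiSum (ρ ^ i) (ρ ^ j) := by
    rw [MulChar.sum_sum_mul_mul_add, ← pow_add, ← pow_add, sum_cubicChar_pow hρ]
  have hexp : ∑ uv : F × F, I (uv.1 * d₁) * I (uv.2 * d₂) * I ((uv.1 + uv.2) * d₃) =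
      (∑ i ∈ Finset.range 3, ∑ j ∈ Finset.range 3, ∑ k ∈ Finset.range 3,
        (ρ ^ i) d₁ * (ρ ^ j) d₂ * (ρ ^ k) d₃ *
          ∑ uv : F × F, (ρ ^ i) uv.1 * (ρ ^ j) uv.2 * (ρ ^ k) (uv.1 + uv.2)) / 27 := by
    simp only [Finset.sum_range_succ, Finset.sum_range_zero, zero_add, hI, map_mul,
      Finset.mul_sum, ← Finset.sum_add_distrib, Finset.sum_div]
    refine Finset.sum_congr rfl fun uv _ => ?_
    ring
  have hne : ρ ≠ 1 := by rintro rfl; simp at hρ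
  have hne2 : ρ ^ 2 ≠ 1 := fun h => by
    have := hρ ▸ orderOf_dvd_iff_pow_eq_one.mpr h
    omega
  have hinv : ρ⁻¹ = ρ ^ 2 := inv_eq_of_mul_eq_one_right (by
    rw [← pow_succ', cubicChar_pow_three hρ])
  have hneg : ρ (-1) = 1 := by
    rw [← cubicChar_apply_cube hρ (neg_ne_zero.mpr one_ne_zero)]; norm_num
  have h01 := jacobiSum_one_nontrivial hne
  have h02 := jacobiSum_one_nontrivial hne2
  have h12 : jacobiSum ρ (ρ ^ 2) = -1 := by
    rw [← hinv, jacobiSum_nontrivial_inv hne, hneg]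
  have one_apply {x : F} (hx : x ≠ 0) : (1 : MulChar F ℂ) x = 1 :=
    MulChar.one_apply (isUnit_iff_ne_zero.mpr hx)
  have inv_apply {x : F} (hx : x ≠ 0) : ρ x⁻¹ = ρ x ^ 2 := by
    rw [← MulChar.inv_apply', hinv, MulChar.pow_apply' ρ two_ne_zero]
  have e₂ := cubicChar_apply_pow_three hρ h₂
  have e₃ := cubicChar_apply_pow_three hρ h₃
  rw [hexp]
  simp only [hT, Finset.sum_range_succ, Finset.sum_range_zero, zero_add, hI, pow_zero, pow_one]
  rw [jacobiSum_comm ρ 1, jacobiSum_comm (ρ ^ 2) 1, jacobiSum_comm (ρ ^ 2) ρ, h01, h02, h12,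
    jacobiSum_one_one]
  simp [one_apply, h₁, h₂, h₃, MulChar.pow_apply' ρ two_ne_zero, inv_apply]
  linear_combination ((Fintype.card F : ℂ) - 1) / 27 *
    ((ρ d₂ ^ 2 * ρ d₃ + ρ d₁ ^ 2 * ρ d₃) * e₃ + ρ d₁ ^ 2 * ρ d₂ * e₂)

end CubicCharacter

/-- For `e = N = 3` and `p` odd, the count `f(c₁,c₂,c₃) = #F(c₁,c₂,c₃)` is
given by the stated formula involving `δ₃`, the quadratic character `χ` and Jacobi sums of
a cubic character `ρ`. -/
theorem stmt_15 (p s m h : ℕ) (hp : p.Prime) (hodd : Odd p) (hs : 1 ≤ s) (hm : 1 ≤ m)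
    (q r : ℕ) (hq : q = p ^ s) (hr : r = q ^ m)
    (hh : 0 < h) (hhq : h ∣ q - 1)
    (he : 3 ∣ Nat.gcd (q - 1) (h * m))
    (hN : Nat.gcd ((r - 1) / (q - 1)) (3 * (q - 1) / h) = 3)
    (F : Type) [Field F] [Fintype F] (hcardF : Fintype.card F = r)
    (α : Fˣ) (hα : ∀ x : Fˣ, x ∈ Subgroup.zpowers α)
    (g β : F) (hg : g = (α : F) ^ ((q - 1) / h)) (hβ : β = (α : F) ^ ((r - 1) / 3))
    (C : Set F) (hC : C = {x : F | x ≠ 0 ∧ ∃ y : F, y ^ 3 = x})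
    (δ : F → ℂ) (hδ : ∀ x : F, δ x = if x ∈ C then 1 else 0)
    (ρ χ : MulChar F ℂ) (hρ : orderOf ρ = 3) (hχ : orderOf χ = 2)
    (c₁ c₂ c₃ : F) (hc₁ : c₁ ≠ 0) (hc₂ : c₂ ≠ 0) (hc₃ : c₃ ≠ 0) :
    (Set.ncard {ab : F × F | (ab.1 + β * ab.2) * g * c₁ ∈ C ∧
        (ab.1 + β ^ 2 * ab.2) * g ^ 2 * c₂ ∈ C ∧
        (ab.1 + β ^ 3 * ab.2) * g ^ 3 * c₃ ∈ C} : ℂ) =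
      ((r : ℂ) - 1) / 27 *
        ((r : ℂ) + 1 - 3 * δ (g ^ 2 * c₂ * c₃⁻¹) - 3 * δ (g * c₁ * c₃⁻¹)
          - 3 * δ (g ^ 2 * c₁ * c₂⁻¹)
          + χ (-3) * (ρ (c₁ * c₂ * c₃) * (∑ x : F, ρ x * ρ (1 - x))
            + (ρ ^ 2) (c₁ * c₂ * c₃) * (∑ x : F, (ρ ^ 2) x * (ρ ^ 2) (1 - x)))) := by
  have h3q : 3 ∣ q - 1 := he.trans (Nat.gcd_dvd_left _ _)
  have h3N : 3 ∣ (r - 1) / (q - 1) := by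
    rw [← hN]
    exact Nat.gcd_dvd_left _ _
  have hqr : q - 1 ∣ r - 1 := by
    rw [hr]
    simpa using Nat.sub_dvd_pow_sub_pow q 1 m
  have h9 : 9 ∣ r - 1 := by
    rw [← Nat.mul_div_cancel' hqr]
    exact mul_dvd_mul h3q h3N
  have hordα : orderOf α = r - 1 := by
    rw [orderOf_eq_card_of_forall_mem_zpowers hα, Nat.card_eq_fintype_card, Fintype.card_units,
      hcardF]
  have hr1 : 1 < r := hcardF ▸ Fintype.one_lt_card
  have hβu : β = ((α ^ ((r - 1) / 3) : Fˣ) : F) := by rw [hβ, Units.val_pow_eq_pow_val]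
  have hβ3 : β ^ 3 = 1 := by
    rw [hβu, ← Units.val_pow_eq_pow_val, ← pow_mul, Nat.div_mul_cancel (by omega), ← hordα,
      pow_orderOf_eq_one, Units.val_one]
  have hβ1 : β ≠ 1 := by
    rw [hβu, Ne, Units.val_eq_one]
    exact pow_ne_one_of_lt_orderOf (by omega) (by omega)
  have hβ0 : β ≠ 0 := by rw [hβu]; exact Units.ne_zero _
  have hg0 : g ≠ 0 := by rw [hg]; exact pow_ne_zero _ α.ne_zero
  have hsum : 1 + β + β ^ 2 = 0 := by
    have : (β - 1) * (1 + β + β ^ 2) = 0 := by linear_combination hβ3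
    exact (mul_eq_zero.mp this).resolve_left (sub_ne_zero.mpr hβ1)
  have hρβ : ρ β = 1 := by
    obtain ⟨k, hk⟩ := h9
    have : β = ((α : F) ^ k) ^ 3 := by
      rw [hβ, ← pow_mul]
      congr 1
      omega
    rw [this, cubicChar_apply_cube hρ (pow_ne_zero _ α.ne_zero)]
  have hρneg : ρ (-1) = 1 := by
    rw [← cubicChar_apply_cube hρ (neg_ne_zero.mpr one_ne_zero)]; norm_num
  have h3 : (3 : F) ≠ 0 := by
    intro h0
    refine hβ1 (sub_eq_zero.mp (pow_eq_zero_iff three_ne_zero |>.mp ?_))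
    linear_combination hβ3 + (β - β ^ 2) * h0
  have hχ3 : χ (-3) = 1 := by
    have hsq : (-3 : F) = (2 * β + 1) ^ 2 := by linear_combination -4 * hsum
    have hne : 2 * β + 1 ≠ 0 := by
      intro h0
      rw [h0] at hsq
      exact h3 (by linear_combination -hsq)
    rw [hsq, map_pow, ← MulChar.pow_apply' χ two_ne_zero, ← hχ, pow_orderOf_eq_one,
      MulChar.one_apply (isUnit_iff_ne_zero.mpr hne)]
  have hδ' (x : F) : δ x = (∑ i ∈ Finset.range 3, (ρ ^ i) x) / 3 := by
    rw [hδ, ← indicator_cubes_eq hρ, hC]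
    simp only [Set.mem_ofPred_eq]
    congr
  have hδ_congr {x y z : F} (hz : ρ z = 1) (hxy : x = y * z) : δ x = δ y := by
    have hz0 : z ≠ 0 := by rintro rfl; simp [MulChar.map_zero] at hz
    have hpow (i : ℕ) : (ρ ^ i) z = 1 := by
      rw [← Units.val_mk0 hz0, MulChar.pow_apply_coe, Units.val_mk0, hz, one_pow]
    simp only [hδ', hxy, map_mul, hpow, mul_one]
  have hρg3 : ρ (g ^ 3) = 1 := cubicChar_apply_cube hρ hg0
  have hρginv : ρ (g ^ 3)⁻¹ = 1 := by
    rw [← MulChar.inv_apply', MulChar.inv_apply_eq_inv', hρg3, inv_one]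
  have hcount : (Set.ncard {ab : F × F | (ab.1 + β * ab.2) * g * c₁ ∈ C ∧
        (ab.1 + β ^ 2 * ab.2) * g ^ 2 * c₂ ∈ C ∧
        (ab.1 + β ^ 3 * ab.2) * g ^ 3 * c₃ ∈ C} : ℂ) =
      ∑ uv : F × F, δ (uv.1 * (g * c₁)) * δ (uv.2 * (g ^ 2 * c₂)) *
        δ ((uv.1 + uv.2) * (g ^ 3 * c₃)) := by
    let φ : F × F → F × F := fun ab =>
      (-(β * (ab.1 + β * ab.2)), -(β ^ 2 * (ab.1 + β ^ 2 * ab.2)))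
    have hφ : Function.Bijective φ := by
      refine Finite.injective_iff_bijective.mp ?_
      rintro ⟨a, b⟩ ⟨a', b'⟩ hab
      obtain ⟨h1, h2⟩ := Prod.mk.inj hab
      have h1' : a + β * b = a' + β * b' := mul_left_cancel₀ hβ0 (neg_injective h1)
      have h2' : a + β ^ 2 * b = a' + β ^ 2 * b' :=
        mul_left_cancel₀ (pow_ne_zero 2 hβ0) (neg_injective h2)
      have hb : b = b' := by
        refine mul_left_cancel₀ (mul_ne_zero hβ0 (sub_ne_zero.mpr hβ1)) ?_
        linear_combination h2' - h1'
      subst hb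
      rw [add_right_cancel h1']
    rw [← hφ.sum_comp, Set.ncard_eq_toFinset_card', Set.toFinset_ofPred, Finset.natCast_card_filter]
    refine Finset.sum_congr rfl fun ab _ => ?_
    have e1 : δ ((φ ab).1 * (g * c₁)) = δ ((ab.1 + β * ab.2) * g * c₁) :=
      hδ_congr (z := -1 * β) (by rw [map_mul, hρneg, hρβ, one_mul]) (by simp only [φ]; ring)
    have e2 : δ ((φ ab).2 * (g ^ 2 * c₂)) = δ ((ab.1 + β ^ 2 * ab.2) * g ^ 2 * c₂) :=
      hδ_congr (z := -1 * β ^ 2) (by rw [map_mul, map_pow, hρneg, hρβ, one_pow, one_mul])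
        (by simp only [φ]; ring)
    have e3 : ((φ ab).1 + (φ ab).2) * (g ^ 3 * c₃) = (ab.1 + β ^ 3 * ab.2) * g ^ 3 * c₃ := by
      simp only [φ]
      linear_combination (-(ab.1 + β ^ 2 * ab.2) * g ^ 3 * c₃) * hsum
    rw [e1, e2, e3, hδ, hδ, hδ]
    simp only [mul_ite, mul_one, mul_zero, ite_and]
    split_ifs <;> rfl
  rw [hcount, sum_indicator_cubes hρ hδ' (mul_ne_zero hg0 hc₁)
    (mul_ne_zero (pow_ne_zero 2 hg0) hc₂) (mul_ne_zero (pow_ne_zero 3 hg0) hc₃), hcardF, hχ3]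
  have d23 : δ (g ^ 2 * c₂ * (g ^ 3 * c₃)⁻¹) = δ (g ^ 2 * c₂ * c₃⁻¹) :=
    hδ_congr hρginv (by rw [mul_inv]; ring)
  have d13 : δ (g * c₁ * (g ^ 3 * c₃)⁻¹) = δ (g * c₁ * c₃⁻¹) :=
    hδ_congr hρginv (by rw [mul_inv]; ring)
  have d12 : δ (g * c₁ * (g ^ 2 * c₂)⁻¹) = δ (g ^ 2 * c₁ * c₂⁻¹) :=
    hδ_congr hρginv (by field_simp)
  have hprod : ρ (g * c₁ * (g ^ 2 * c₂) * (g ^ 3 * c₃)) = ρ (c₁ * c₂ * c₃) := by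
    have : g * c₁ * (g ^ 2 * c₂) * (g ^ 3 * c₃) = g ^ 3 * g ^ 3 * (c₁ * c₂ * c₃) := by ring
    rw [this, map_mul, map_mul, hρg3, one_mul, one_mul]
  rw [d23, d13, d12, one_mul, MulChar.pow_apply' ρ two_ne_zero (_ * _),
    MulChar.pow_apply' ρ two_ne_zero (_ * _), hprod]
  rfl
end

section
/- Assume e = N = 3 and p = 2. For c₁, c₂, c₃ ∈ GF(r)^*, let F(c₁,c₂,c₃) = {(a,b) ∈ GF(r)² : (a + β^i b)·g^i·c_i ∈ C^{(3,r)} for i = 1, 2, 3} and f(c₁,c₂,c₃) = #F(c₁,c₂,c₃), and let δ₃(x) = 1 if x ∈ C^{(3,r)} and δ₃(x) = 0 otherwise. Then f(c₁,c₂,c₃) = ((r−1)/27)·( r + 2 + 3·η_{(c₁c₂c₃)²}^{(3,r)} − 3δ₃(g² c₂ c₃^{−1}) − 3δ₃(g c₁ c₃^{−1}) − 3δ₃(g² c₁ c₂^{−1}) ). -/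
open scoped Classical

/-- A `3`-periodic function on `ℤ` sums to `n` times its sum over one period. -/
theorem sum_range_three_mul_of_periodic (f : ℤ → ℂ) (hf : ∀ k, f (k + 3) = f k) (n : ℕ) :
    ∑ k ∈ Finset.range (3 * n), f k = n * (f 0 + f 1 + f 2) := by
  have hper : ∀ (k : ℕ) (j : ℤ), f (3 * k + j) = f j := by
    intro k j
    induction k with
    | zero => simp
    | succ k ih => rw [← ih, ← hf (3 * k + j)]; push_cast; ring_nf
  induction n with
  | zero => simp
  | succ n ih =>
    rw [show 3 * (n + 1) = 3 * n + 1 + 1 + 1 by ring, Finset.sum_range_succ,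
      Finset.sum_range_succ, Finset.sum_range_succ, ih]
    have h0 := hper n 0
    have h1 := hper n 1
    have h2 := hper n 2
    push_cast
    rw [add_zero] at h0
    rw [h0, h1, h2]
    ring

theorem cubic_period_identity (A B n : ℂ) (hA : A = -1 - 2 * B) (hn : n = 3 * B ^ 2 + 2 * B)
    (E : ZMod 3 → ℂ) (h0 : E 0 = A) (h1 : E 1 = B) (h2 : E 2 = B) (k₁ k₂ k₃ : ZMod 3) :
    9 * (n ^ 2 + (E k₁ * E k₂ * E k₃ + E (1 + k₁) * E (1 + k₂) * E (1 + k₃) +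
      E (2 + k₁) * E (2 + k₂) * E (2 + k₃))) =
    (3 * n + 1) * (3 * n + 1 + 2 + 3 * E (k₁ + k₂ + k₃) - 3 * (if k₂ = k₃ then 1 else 0)
      - 3 * (if k₁ = k₃ then 1 else 0) - 3 * (if k₁ = k₂ then 1 else 0)) := by
  have hcases : ∀ k : ZMod 3, k = 0 ∨ k = 1 ∨ k = 2 := by decide
  have e11 : (1 : ZMod 3) + 1 = 2 := rfl
  have e12 : (1 : ZMod 3) + 2 = 0 := rfl
  have e21 : (2 : ZMod 3) + 1 = 0 := rfl
  have e22 : (2 : ZMod 3) + 2 = 1 := rfl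
  have n01 : (0 : ZMod 3) ≠ 1 := by decide
  have n02 : (0 : ZMod 3) ≠ 2 := by decide
  have n12 : (1 : ZMod 3) ≠ 2 := by decide
  rcases hcases k₁ with rfl | rfl | rfl <;> rcases hcases k₂ with rfl | rfl | rfl <;>
    rcases hcases k₃ with rfl | rfl | rfl <;>
    simp only [add_zero, zero_add, e11, e12, e21, e22, h0, h1, h2, n01, n02, n12, n01.symm,
      n02.symm, n12.symm, if_true, if_false] <;>
    subst hA hn <;> ring

theorem AddChar.sum_prod_three {F : Type} [Field F] [Fintype F] (ψ : AddChar F ℂ)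
    (hψ : ψ.IsPrimitive) (C : Finset F) (u₁ u₂ u₃ : F) :
    ∑ t, (∑ z ∈ C, ψ (z * (t * u₁))) * (∑ z ∈ C, ψ (z * (t * u₂))) *
      (∑ z ∈ C, ψ (z * (t * u₃))) =
    Fintype.card F * ((C ×ˢ C ×ˢ C).filter
      (fun z => z.1 * u₁ + z.2.1 * u₂ + z.2.2 * u₃ = 0)).card := by
  have h : ∀ t, (∑ z ∈ C, ψ (z * (t * u₁))) * (∑ z ∈ C, ψ (z * (t * u₂))) *
      (∑ z ∈ C, ψ (z * (t * u₃))) =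
      ∑ z ∈ C ×ˢ C ×ˢ C, ψ (t * (z.1 * u₁ + z.2.1 * u₂ + z.2.2 * u₃)) := by
    intro t
    rw [mul_assoc, Finset.sum_mul_sum, Finset.sum_mul_sum, ← Finset.sum_product']
    simp only [Finset.sum_product, Finset.mul_sum, ← AddChar.map_add_eq_mul]
    refine Finset.sum_congr rfl fun x _ => Finset.sum_congr rfl fun y _ =>
      Finset.sum_congr rfl fun z _ => ?_
    congr 1
    ring
  simp only [h]
  rw [Finset.sum_comm, Finset.card_filter]
  simp only [AddChar.sum_mulShift _ hψ]
  push_cast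
  rw [Finset.mul_sum]
  refine Finset.sum_congr rfl fun z _ => ?_
  split_ifs <;> simp

theorem orderOf_generator_units {F : Type} [Field F] [Fintype F] {α : Fˣ}
    (hα : ∀ x : Fˣ, x ∈ Subgroup.zpowers α) {N : ℕ} (hcard : Fintype.card F = N + 1) :
    orderOf α = N := by
  rw [orderOf_eq_card_of_forall_mem_zpowers hα, Nat.card_eq_fintype_card, Fintype.card_units,
    hcard, Nat.add_sub_cancel]

theorem sum_eq_zero_add_sum_zpow {F : Type} [Field F] [Fintype F] (α : Fˣ)
    (hα : ∀ x : Fˣ, x ∈ Subgroup.zpowers α) (n : ℕ) (hcard : Fintype.card F = 3 * n + 1)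
    (f : F → ℂ) (hf : ∀ k : ℤ, f ((α ^ (k + 3) : Fˣ) : F) = f ((α ^ k : Fˣ) : F)) :
    ∑ t, f t = f 0 + n * (f 1 + f α + f ((α ^ (2 : ℤ) : Fˣ) : F)) := by
  have hord : orderOf α = 3 * n := orderOf_generator_units hα hcard
  have hu : ∑ t : Fˣ, f t = ∑ k ∈ Finset.range (3 * n), f ((α ^ (k : ℤ) : Fˣ) : F) := by
    have : (Finset.univ : Finset Fˣ) = (Finset.range (orderOf α)).image (α ^ ·) := by
      ext x
      simp only [Finset.mem_univ, true_iff]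
      exact (mem_zpowers_iff_mem_range_orderOf).1 (hα x)
    rw [this, Finset.sum_image, hord]
    · simp
    · intro a ha b hb hab
      exact pow_injOn_Iio_orderOf (by simpa using ha) (by simpa using hb) hab
  have := sum_range_three_mul_of_periodic (fun k => f ((α ^ k : Fˣ) : F)) hf n
  rw [← Fintype.sum_subtype_add_sum_subtype (fun t : F => t = 0)]
  rw [← hu] at this
  simp only [zpow_zero, zpow_one, Units.val_one] at this
  rw [← this]
  congr 1
  · simp [show ((default : {t : F // t = 0}) : F) = 0 from (default : {t : F // t = 0}).2]
  · exact (Fintype.sum_equiv unitsEquivNeZero _ _ (fun x => rfl)).symm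


theorem zpow_mem_cubes_iff {F : Type} [Field F] [Fintype F] {α : Fˣ}
    (hα : ∀ x : Fˣ, x ∈ Subgroup.zpowers α) {n : ℕ} (hcard : Fintype.card F = 3 * n + 1) (k : ℤ) :
    (∃ y : F, y ^ 3 = ((α ^ k : Fˣ) : F)) ↔ 3 ∣ k := by
  have hord : orderOf α = 3 * n := orderOf_generator_units hα hcard
  constructor
  · rintro ⟨y, hy⟩
    have hy0 : y ≠ 0 := by
      rintro rfl
      exact (α ^ k).ne_zero (by rw [← hy]; simp)
    obtain ⟨j, hj⟩ := Subgroup.mem_zpowers_iff.1 (hα (Units.mk0 y hy0))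
    have h1 : α ^ (j * 3) = α ^ k := by
      rw [zpow_mul, hj]
      ext
      simpa using hy
    have h2 : α ^ (j * 3 - k) = 1 := by rw [zpow_sub, h1, mul_inv_cancel]
    have h3 := orderOf_dvd_iff_zpow_eq_one.2 h2
    rw [hord] at h3
    push_cast at h3
    have h4 : (3 : ℤ) ∣ j * 3 - k := (Dvd.intro _ rfl).trans h3
    omega
  · rintro ⟨j, rfl⟩
    refine ⟨((α ^ j : Fˣ) : F), ?_⟩
    rw [mul_comm, zpow_mul]
    norm_cast

/-- The number of zero-sum triples in three prescribed cosets of the cubes of a finite field of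
characteristic two, in terms of the cubic Gaussian periods. -/
theorem card_cube_triples {F : Type} [Field F] [Fintype F] [CharP F 2] (ψ : AddChar F ℂ)
    (hψ : ψ.IsPrimitive) (hfrob : ∀ x, ψ (x ^ 2) = ψ x)
    {α : Fˣ} (hα : ∀ x : Fˣ, x ∈ Subgroup.zpowers α) {n : ℕ} (hn : n ≠ 0)
    (hcard : Fintype.card F = 3 * n + 1)
    (C : Finset F) (hC : ∀ x, x ∈ C ↔ x ≠ 0 ∧ ∃ y : F, y ^ 3 = x) (k₁ k₂ k₃ k : ℤ)
    (hk : (k : ZMod 3) = k₁ + k₂ + k₃) :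
    (((C ×ˢ C ×ˢ C).filter (fun z => z.1 * ((α ^ k₁ : Fˣ) : F) + z.2.1 * ((α ^ k₂ : Fˣ) : F) +
      z.2.2 * ((α ^ k₃ : Fˣ) : F) = 0)).card : ℂ) =
    n / 9 * (3 * n + 1 + 2 + 3 * (∑ z ∈ C, ψ (z * ((α ^ k : Fˣ) : F)))
      - 3 * (if (k₂ : ZMod 3) = k₃ then 1 else 0) - 3 * (if (k₁ : ZMod 3) = k₃ then 1 else 0)
      - 3 * (if (k₁ : ZMod 3) = k₂ then 1 else 0)) := by
  set η : F → ℂ := fun u => ∑ z ∈ C, ψ (z * u) with hη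
  have hCk : ∀ k : ℤ, ((α ^ k : Fˣ) : F) ∈ C ↔ 3 ∣ k := fun k => by
    rw [hC, ← zpow_mem_cubes_iff hα hcard k]
    exact and_iff_right (Units.ne_zero _)
  have hCcard : (C.card : ℂ) = n := by
    have := sum_eq_zero_add_sum_zpow α hα n hcard (fun x => if x ∈ C then 1 else 0) (fun k => by
      simp only [hCk, dvd_add_self_right])
    rw [Finset.sum_boole] at this
    simp only [Finset.filter_mem_eq_inter, Finset.univ_inter] at this
    rw [this]
    have h0 : (0 : F) ∉ C := fun h => ((hC 0).1 h).1 rfl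
    have h1 : (1 : F) ∈ C := by simpa using (hCk 0).2 (by norm_num)
    have h2 : (α : F) ∉ C := by simpa using (hCk 1).not.2 (by norm_num)
    have h3 := (hCk 2).not.2 (by norm_num)
    rw [if_neg h0, if_pos h1, if_neg h2, if_neg h3]
    ring
  have hη0 : η 0 = n := by simp [hη, hCcard]
  have hper : ∀ (a : Fˣ) (u : F), η (((a ^ 3 : Fˣ) : F) * u) = η u := by
    intro a u
    refine Finset.sum_bij' (fun z _ => z * ((a ^ 3 : Fˣ) : F))
      (fun z _ => z * ((a⁻¹ ^ 3 : Fˣ) : F)) ?_ ?_ ?_ ?_ ?_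
    · intro z hz
      obtain ⟨h1, y, rfl⟩ := (hC z).1 hz
      exact (hC _).2 ⟨mul_ne_zero h1 (Units.ne_zero _), y * a, by push_cast; ring⟩
    · intro z hz
      obtain ⟨h1, y, rfl⟩ := (hC z).1 hz
      exact (hC _).2 ⟨mul_ne_zero h1 (Units.ne_zero _), y * (a⁻¹ : Fˣ), by push_cast; ring⟩
    · intro z _
      rw [mul_assoc, ← Units.val_mul, ← mul_pow]; simp
    · intro z _
      rw [mul_assoc, ← Units.val_mul, ← mul_pow]; simp
    · intro z _
      rw [mul_assoc]
  have hper3 : ∀ (k : ℤ) (u : F), η (((α ^ (k + 3) : Fˣ) : F) * u) =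
      η (((α ^ k : Fˣ) : F) * u) := by
    intro k u
    rw [← hper α (((α ^ k : Fˣ) : F) * u), ← mul_assoc, ← Units.val_mul]
    congr 3
    rw [zpow_add, mul_comm]; rfl
  have hsq : ∀ u, η (u ^ 2) = η u := by
    intro u
    have hinj : Set.InjOn (fun z : F => z ^ 2) C := fun x _ y _ h =>
      CharTwo.sq_injective h
    have himg : C.image (fun z : F => z ^ 2) = C := by
      refine Finset.eq_of_subset_of_card_le ?_ (Finset.card_image_of_injOn hinj).ge
      intro z hz
      obtain ⟨x, hx, rfl⟩ := Finset.mem_image.1 hz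
      obtain ⟨h1, y, rfl⟩ := (hC x).1 hx
      exact (hC _).2 ⟨pow_ne_zero 2 h1, y ^ 2, by ring⟩
    calc η (u ^ 2) = ∑ z ∈ C.image (fun z : F => z ^ 2), ψ (z * u ^ 2) := by rw [himg]
      _ = ∑ z ∈ C, ψ (z ^ 2 * u ^ 2) := Finset.sum_image hinj
      _ = η u := by simp only [← mul_pow, hfrob, hη]
  set E : ZMod 3 → ℂ := fun a => η ((α ^ (a.val : ℤ) : Fˣ) : F) with hE
  have hEk : ∀ k : ℤ, η ((α ^ k : Fˣ) : F) = E k := by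
    intro k
    simp only [hE]
    rw [ZMod.val_intCast, ← hper (α ^ (k / 3)) ((α ^ (k % (3 : ℕ)) : Fˣ) : F), ← Units.val_mul, ← zpow_natCast, ← zpow_mul,
      ← zpow_add]
    congr 3
    push_cast
    omega
  have h1 : E 1 = η α := by simpa using (hEk 1).symm
  have h0 : E 0 = η 1 := by simpa using (hEk 0).symm
  have h2 : E 2 = η ((α ^ (2 : ℤ) : Fˣ) : F) := by simpa using (hEk 2).symm
  have h12 : E 2 = E 1 := by
    rw [h1, h2, ← hsq α]; norm_cast
  have hnC : (n : ℂ) ≠ 0 := Nat.cast_ne_zero.2 hn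
  have key : ∀ u₁ u₂ u₃ : F, (n : ℂ) ^ 3 + n * (η u₁ * η u₂ * η u₃ +
      η (α * u₁) * η (α * u₂) * η (α * u₃) + η (((α ^ (2 : ℤ) : Fˣ) : F) * u₁) *
      η (((α ^ (2 : ℤ) : Fˣ) : F) * u₂) * η (((α ^ (2 : ℤ) : Fˣ) : F) * u₃)) =
      (3 * n + 1) * ((C ×ˢ C ×ˢ C).filter
      (fun z => z.1 * u₁ + z.2.1 * u₂ + z.2.2 * u₃ = 0)).card := by
    intro u₁ u₂ u₃
    have h := AddChar.sum_prod_three ψ hψ C u₁ u₂ u₃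
    rw [hcard] at h
    push_cast at h
    rw [← h]
    have h' := sum_eq_zero_add_sum_zpow α hα n hcard
      (fun t => η (t * u₁) * η (t * u₂) * η (t * u₃)) (fun k => by simp only [hper3])
    simp only [zero_mul, hη0, one_mul] at h'
    rw [h']
    ring
  have hlin : E 0 = -1 - 2 * E 1 := by
    have h := key 1 0 0
    rw [Finset.filter_false_of_mem] at h
    · simp only [mul_zero, mul_one, hη0, ← h0, ← h1, ← h2, h12, Finset.card_empty,
        Nat.cast_zero] at h
      have : (n : ℂ) ^ 3 * (1 + E 0 + 2 * E 1) = 0 := by linear_combination h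
      have := (mul_eq_zero.1 this).resolve_left (pow_ne_zero 3 hnC)
      linear_combination this
    · intro z hz
      simp only [Finset.mem_product] at hz
      simpa using ((hC _).1 hz.1).1
  have hquad : (n : ℂ) = 3 * E 1 ^ 2 + 2 * E 1 := by
    have h := key 1 1 0
    have hc : ((C ×ˢ C ×ˢ C).filter
        (fun z : F × F × F => z.1 * 1 + z.2.1 * 1 + z.2.2 * 0 = 0)).card = (C ×ˢ C).card := by
      refine Finset.card_bij' (fun z _ => z.2) (fun z _ => (z.1, z)) ?_ ?_ ?_ ?_
      · intro z hz
        exact (Finset.mem_product.1 (Finset.mem_filter.1 hz).1).2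
      · intro z hz
        simp [Finset.mem_product.1 hz, CharTwo.add_self_eq_zero]
      · intro z hz
        have := (Finset.mem_filter.1 hz).2
        simp only [mul_one, mul_zero, add_zero, CharTwo.add_eq_zero] at this
        simp [← this]
      · intro z _
        rfl
    rw [hc, Finset.card_product, Nat.cast_mul] at h
    simp only [mul_zero, mul_one, hη0, ← h0, ← h1, ← h2, h12, hCcard] at h
    have : (n : ℂ) ^ 2 * (n + (E 0 ^ 2 + 2 * E 1 ^ 2) - (3 * n + 1)) = 0 := by
      linear_combination h
    have := (mul_eq_zero.1 this).resolve_left (pow_ne_zero 2 hnC)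
    rw [hlin] at this
    linear_combination (-1 / 2) * this
  have h := key ((α ^ k₁ : Fˣ) : F) ((α ^ k₂ : Fˣ) : F) ((α ^ k₃ : Fˣ) : F)
  have hα1 : (α : F) = ((α ^ (1 : ℤ) : Fˣ) : F) := by simp
  rw [hα1] at h
  simp only [← Units.val_mul, ← zpow_add, hEk, Int.cast_add, Int.cast_one, Int.cast_ofNat] at h
  have hid := cubic_period_identity (E 0) (E 1) n hlin hquad E rfl rfl h12 k₁ k₂ k₃
  change _ = (n : ℂ) / 9 * (3 * n + 1 + 2 + 3 * η ((α ^ k : Fˣ) : F) - _ - _ - _)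
  rw [hEk, hk]
  have hr : (3 * n + 1 : ℂ) ≠ 0 := by exact_mod_cast (3 * n).succ_ne_zero
  apply mul_left_cancel₀ hr
  rw [← h]
  linear_combination (n / 9 : ℂ) * hid

/-- The linear forms `a + β b`, `a + β² b`, `a + b`, rescaled by `β`, `β²`, `1`, parametrize the
zero-sum triples when `β` is a primitive cube root of unity in characteristic two. -/
theorem ncard_linear_forms_eq_card_triples {F : Type} [Field F] [Fintype F] [CharP F 2] {β : F}
    (hβ : β ^ 2 + β + 1 = 0) (C : Finset F) (hCβ : ∀ x ∈ C, β * x ∈ C) {d₁ d₂ d₃ : F}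
    (hd₁ : d₁ ≠ 0) (hd₂ : d₂ ≠ 0) (hd₃ : d₃ ≠ 0) :
    Set.ncard {ab : F × F | (ab.1 + β * ab.2) * d₁ ∈ C ∧ (ab.1 + β ^ 2 * ab.2) * d₂ ∈ C ∧
      (ab.1 + ab.2) * d₃ ∈ C} =
    ((C ×ˢ C ×ˢ C).filter
      (fun z => z.1 * d₁⁻¹ + z.2.1 * d₂⁻¹ + z.2.2 * d₃⁻¹ = 0)).card := by
  have h2 : (2 : F) = 0 := CharTwo.two_eq_zero
  have hβ3 : β ^ 3 = 1 := by linear_combination (β - 1) * hβ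
  have hinv : ∀ X Y Z : F, X + Y + Z = 0 →
      (X + β ^ 2 * Z) + β * (X + β * Z) = β ^ 2 * X ∧
      (X + β ^ 2 * Z) + β ^ 2 * (X + β * Z) = β * Y ∧ (X + β ^ 2 * Z) + (X + β * Z) = Z := by
    intro X Y Z hz
    refine ⟨?_, ?_, ?_⟩
    · linear_combination X * hβ + (β ^ 2 * Z - β ^ 2 * X) * h2
    · linear_combination (X + β * Z) * hβ - β * hz
    · linear_combination Z * hβ + (X - Z) * h2
  rw [show {ab : F × F | (ab.1 + β * ab.2) * d₁ ∈ C ∧ (ab.1 + β ^ 2 * ab.2) * d₂ ∈ C ∧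
      (ab.1 + ab.2) * d₃ ∈ C} = ((Finset.univ.filter fun ab : F × F =>
      (ab.1 + β * ab.2) * d₁ ∈ C ∧ (ab.1 + β ^ 2 * ab.2) * d₂ ∈ C ∧ (ab.1 + ab.2) * d₃ ∈ C :
      Finset (F × F)) : Set (F × F)) by ext; simp, Set.ncard_coe_finset]
  refine Finset.card_bij'
    (fun ab _ => (β * ((ab.1 + β * ab.2) * d₁), β * (β * ((ab.1 + β ^ 2 * ab.2) * d₂)),
      (ab.1 + ab.2) * d₃))
    (fun z _ => (z.1 * d₁⁻¹ + β ^ 2 * (z.2.2 * d₃⁻¹), z.1 * d₁⁻¹ + β * (z.2.2 * d₃⁻¹)))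
    ?_ ?_ ?_ ?_
  · rintro ⟨a, b⟩ hab
    obtain ⟨h1, h2, h3⟩ := (Finset.mem_filter.1 hab).2
    refine Finset.mem_filter.2 ⟨Finset.mem_product.2 ⟨hCβ _ h1, Finset.mem_product.2
      ⟨hCβ _ (hCβ _ h2), h3⟩⟩, ?_⟩
    field_simp
    linear_combination (a + b * (β ^ 2 - β + 1)) * hβ
  · rintro ⟨z₁, z₂, z₃⟩ hz
    obtain ⟨hzC, hz0⟩ := Finset.mem_filter.1 hz
    simp only [Finset.mem_product] at hzC hz0
    obtain ⟨e1, e2, e3⟩ := hinv _ _ _ hz0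
    refine Finset.mem_filter.2 ⟨Finset.mem_univ _, ?_⟩
    simp only [e1, e2, e3]
    refine ⟨?_, ?_, ?_⟩
    · rw [show β ^ 2 * (z₁ * d₁⁻¹) * d₁ = β * (β * z₁) by field_simp]
      exact hCβ _ (hCβ _ hzC.1)
    · rw [show β * (z₂ * d₂⁻¹) * d₂ = β * z₂ by field_simp]
      exact hCβ _ hzC.2.1
    · rw [show z₃ * d₃⁻¹ * d₃ = z₃ by field_simp]
      exact hzC.2.2
  · rintro ⟨a, b⟩ _
    ext
    · field_simp
      linear_combination a * hβ + (β ^ 2 * b - a) * h2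
    · field_simp
      linear_combination b * hβ + (β * a - b) * h2
  · rintro ⟨z₁, z₂, z₃⟩ hz
    obtain ⟨e1, e2, e3⟩ := hinv _ _ _ (Finset.mem_filter.1 hz).2
    simp only [e1, e2, e3]
    refine Prod.ext ?_ (Prod.ext ?_ ?_)
    · field_simp
      linear_combination z₁ * hβ3
    · field_simp
      linear_combination z₂ * hβ3
    · field_simp

/-- For `e = N = 3` and `p = 2`, the count `f(c₁,c₂,c₃) = #F(c₁,c₂,c₃)` is
given by the stated formula involving `δ₃` and the Gaussian period `η_{(c₁c₂c₃)²}`. -/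
theorem stmt_16 (s m h : ℕ) (hs : 1 ≤ s) (hm : 1 ≤ m)
    (q r : ℕ) (hq : q = 2 ^ s) (hr : r = q ^ m)
    (hh : 0 < h) (hhq : h ∣ q - 1)
    (he : 3 ∣ Nat.gcd (q - 1) (h * m))
    (hN : Nat.gcd ((r - 1) / (q - 1)) (3 * (q - 1) / h) = 3)
    (F : Type) [Field F] [Fintype F] [Algebra (ZMod 2) F]
    (hcardF : Fintype.card F = r)
    (α : Fˣ) (hα : ∀ x : Fˣ, x ∈ Subgroup.zpowers α)
    (g β : F) (hg : g = (α : F) ^ ((q - 1) / h)) (hβ : β = (α : F) ^ ((r - 1) / 3))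
    (C : Set F) (hC : C = {x : F | x ≠ 0 ∧ ∃ y : F, y ^ 3 = x})
    (δ : F → ℂ) (hδ : ∀ x : F, δ x = if x ∈ C then 1 else 0)
    (ψ : F → ℂ)
    (hψ : ∀ x : F, ψ x = (-1 : ℂ) ^ (ZMod.val (Algebra.trace (ZMod 2) F x)))
    (η : F → ℂ)
    (hη : ∀ u : F, η u = ∑ z ∈ Finset.univ.filter (fun x : F => x ∈ C), ψ (z * u))
    (c₁ c₂ c₃ : F) (hc₁ : c₁ ≠ 0) (hc₂ : c₂ ≠ 0) (hc₃ : c₃ ≠ 0) :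
    (Set.ncard {ab : F × F | (ab.1 + β * ab.2) * g * c₁ ∈ C ∧
        (ab.1 + β ^ 2 * ab.2) * g ^ 2 * c₂ ∈ C ∧
        (ab.1 + β ^ 3 * ab.2) * g ^ 3 * c₃ ∈ C} : ℂ) =
      ((r : ℂ) - 1) / 27 *
        ((r : ℂ) + 2 + 3 * η ((c₁ * c₂ * c₃) ^ 2)
          - 3 * δ (g ^ 2 * c₂ * c₃⁻¹) - 3 * δ (g * c₁ * c₃⁻¹)
          - 3 * δ (g ^ 2 * c₁ * c₂⁻¹)) := by
  have hinj : Function.Injective (algebraMap (ZMod 2) F) := (algebraMap (ZMod 2) F).injective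
  have : CharP F 2 := charP_of_injective_algebraMap hinj 2
  have hneg : (-1 : ℂ) ^ 2 = 1 := by norm_num
  let χ : AddChar F ℂ := (AddChar.zmodChar 2 hneg).compAddMonoidHom
    (Algebra.trace (ZMod 2) F).toAddMonoidHom
  have hχ : ∀ x, χ x = ψ x := fun x => by
    rw [hψ]; exact AddChar.zmodChar_apply hneg _
  have hprim : χ.IsPrimitive := by
    refine AddChar.IsPrimitive.of_ne_one fun h => ?_
    obtain ⟨x, hx⟩ := Algebra.trace_surjective (ZMod 2) F 1
    have h1 : χ x = 1 := by rw [h]; rfl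
    rw [hχ, hψ, hx, ZMod.val_one] at h1
    norm_num at h1
  have hfrob : ∀ x, χ (x ^ 2) = χ x := fun x => by
    have h := Algebra.trace_eq_of_algEquiv
      (FiniteField.frobeniusAlgEquivOfAlgebraic (ZMod 2) F) x
    rw [FiniteField.coe_frobeniusAlgEquivOfAlgebraic, ZMod.card] at h
    rw [hχ, hχ, hψ, hψ, h]
  have hq2 : 2 ≤ q := hq ▸ Nat.le_self_pow (by omega) 2
  have h3q : 3 ∣ q - 1 := he.trans (Nat.gcd_dvd_left _ _)
  have hqr : q - 1 ∣ r - 1 := by simpa [hr] using Nat.sub_dvd_pow_sub_pow q 1 m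
  have h9 : 3 * 3 ∣ r - 1 := by
    obtain ⟨t, ht⟩ := hqr
    have h3 : 3 ∣ (r - 1) / (q - 1) := hN ▸ Nat.gcd_dvd_left _ _
    rw [ht, Nat.mul_div_cancel_left _ (by omega)] at h3
    rw [ht]
    exact mul_dvd_mul h3q h3
  obtain ⟨n', hn'⟩ := h9
  have hr2 : 2 ≤ r := hcardF ▸ Fintype.one_lt_card
  obtain ⟨n, hn⟩ : ∃ n, n = 3 * n' := ⟨_, rfl⟩
  have hrn : r = 3 * n + 1 := by omega
  have hn0 : n ≠ 0 := by omega
  have hcard : Fintype.card F = 3 * n + 1 := hcardF.trans hrn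
  have hord : orderOf α = 3 * n := orderOf_generator_units hα hcard
  have hβn : β = (α : F) ^ n := by rw [hβ, hrn]; congr 1; omega
  have hβ3 : β ^ 3 = 1 := by
    rw [hβn, ← pow_mul, mul_comm, ← hord, ← Units.val_pow_eq_pow_val, pow_orderOf_eq_one, Units.val_one]
  have hβ1 : β ≠ 1 := by
    intro h
    have h1 : α ^ n = 1 := by ext; simpa [← hβn] using h
    have := Nat.le_of_dvd (by omega) (orderOf_dvd_of_pow_eq_one h1)
    omega
  have hβ2 : β ^ 2 + β + 1 = 0 := by
    refine (mul_eq_zero.1 (?_ : (β - 1) * (β ^ 2 + β + 1) = 0)).resolve_left (sub_ne_zero.2 hβ1)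
    linear_combination hβ3
  set C' : Finset F := Finset.univ.filter (fun x : F => x ∈ C) with hC'
  have hmem : ∀ x, x ∈ C' ↔ x ∈ C := fun x => by simp [hC']
  have hCC : ∀ x, x ∈ C' ↔ x ≠ 0 ∧ ∃ y : F, y ^ 3 = x := fun x => by rw [hmem, hC]; rfl
  have hCk : ∀ k : ℤ, ((α ^ k : Fˣ) : F) ∈ C ↔ 3 ∣ k := fun k => by
    rw [← hmem, hCC, ← zpow_mem_cubes_iff hα hcard k]
    exact and_iff_right (Units.ne_zero _)
  have hCβ : ∀ x ∈ C', β * x ∈ C' := by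
    intro x hx
    obtain ⟨h1, y, rfl⟩ := (hCC x).1 hx
    refine (hCC _).2 ⟨mul_ne_zero (by rintro rfl; simp at hβ3) h1, (α : F) ^ n' * y, ?_⟩
    rw [hβn, hn]
    ring
  have hlog : ∀ c : F, c ≠ 0 → ∃ l : ℤ, c = ((α ^ l : Fˣ) : F) := fun c hc => by
    obtain ⟨l, hl⟩ := Subgroup.mem_zpowers_iff.1 (hα (Units.mk0 c hc))
    exact ⟨l, by rw [hl]; rfl⟩
  obtain ⟨l₁, rfl⟩ := hlog c₁ hc₁
  obtain ⟨l₂, rfl⟩ := hlog c₂ hc₂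
  obtain ⟨l₃, rfl⟩ := hlog c₃ hc₃
  obtain ⟨e, rfl⟩ := hlog g (by rw [hg]; exact pow_ne_zero _ (Units.ne_zero _))
  have hcount := ncard_linear_forms_eq_card_triples hβ2 C' hCβ
    (Units.ne_zero (α ^ (e + l₁))) (Units.ne_zero (α ^ (2 * e + l₂)))
    (Units.ne_zero (α ^ (3 * e + l₃)))
  simp only [← Units.val_inv_eq_inv_val, ← zpow_neg, hmem] at hcount
  have hthree : (3 : ZMod 3) = 0 := rfl
  have hmain := card_cube_triples χ hprim hfrob hα hn0 hcard C' hCC (-(e + l₁)) (-(2 * e + l₂))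
    (-(3 * e + l₃)) (2 * (l₁ + l₂ + l₃)) (by
      push_cast
      linear_combination (l₁ + l₂ + l₃ + 2 * e : ZMod 3) * hthree)
  rw [← hcount] at hmain
  simp only [ZMod.intCast_eq_intCast_iff_dvd_sub, hχ, ← hη] at hmain
  have hpow : ∀ (k : ℤ) (j : ℕ), ((α ^ k : Fˣ) : F) ^ j = ((α ^ (j * k) : Fˣ) : F) := by
    intro k j
    rw [mul_comm, zpow_mul]
    norm_cast
  simp only [hδ, hpow, ← Units.val_inv_eq_inv_val, ← Units.val_mul, ← zpow_neg, ← zpow_add,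
    mul_assoc, hβ3, one_mul, hCk] at hmain ⊢
  push_cast at hmain ⊢
  rw [hmain, hrn,
    if_congr (show 3 ∣ -(3 * e + l₃) - -(2 * e + l₂) ↔ 3 ∣ 2 * e + l₂ + -l₃ by omega) rfl rfl,
    if_congr (show 3 ∣ -(3 * e + l₃) - -(e + l₁) ↔ 3 ∣ e + l₁ + -l₃ by omega) rfl rfl,
    if_congr (show 3 ∣ -(2 * e + l₂) - -(e + l₁) ↔ 3 ∣ 2 * e + l₁ + -l₂ by omega) rfl rfl]
  push_cast
  ring
end

section
/- Assume e = N = 3. Then for every b ∈ GF(r)^*: w(c_{(−βb, b)}) = h(r−1)/q − (h/q)·( (r−1)/3 + η_{bg²(β−1)}^{(3,r)} + η_{b(β−1)}^{(3,r)} ); w(c_{(−β²b, b)}) = h(r−1)/q − (h/q)·( (r−1)/3 + η_{bg(β−1)}^{(3,r)} + η_{b(β−1)}^{(3,r)} ); and w(c_{(−b, b)}) = h(r−1)/q − (h/q)·( (r−1)/3 + η_{bg(β−1)}^{(3,r)} + η_{bg²(β−1)}^{(3,r)} ). -/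
open scoped Classical

/-- Summing a function over a finite group through a homomorphism counts every element of the
range `#ker` times. -/
theorem MonoidHom.sum_comp_eq_card_ker_nsmul {G H M : Type*} [Group G] [Group H] [Fintype G]
    [AddCommMonoid M] (f : G →* H) (s : Finset H) (hs : ∀ y, y ∈ s ↔ y ∈ f.range) (φ : H → M) :
    ∑ x, φ (f x) = Nat.card f.ker • ∑ y ∈ s, φ y := by
  rw [← Finset.sum_fiberwise_of_maps_to (s := Finset.univ) (t := s) (g := f)
    (fun x _ => (hs _).2 ⟨x, rfl⟩), Finset.smul_sum]
  refine Finset.sum_congr rfl fun y hy => ?_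
  rw [Finset.sum_congr rfl (g := fun _ => φ y) (by simp +contextual), Finset.sum_const]
  congr 1
  rw [MonoidHom.card_fiber_eq_of_mem_range f ((hs y).1 hy) ⟨1, map_one f⟩, Nat.card_eq_fintype_card,
    Fintype.card_subtype]
  simp [MonoidHom.mem_ker]

/-- The units of a finite subfield are generated by the appropriate power of a primitive element. -/
theorem range_unitsMap_algebraMap_eq_zpowers {K F : Type*} [Field K] [Field F] [Algebra K F]
    [Fintype K] [Fintype F] {α : Fˣ} (hα : ∀ x : Fˣ, x ∈ Subgroup.zpowers α) {A : ℕ}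
    (hA : Fintype.card F - 1 = A * (Fintype.card K - 1)) :
    (Units.map (algebraMap K F : K →* F)).range = Subgroup.zpowers (α ^ A) := by
  have hord : orderOf α = Fintype.card F - 1 := by
    rw [orderOf_eq_card_of_forall_mem_zpowers hα, Nat.card_eq_fintype_card, Fintype.card_units]
  have hK : 0 < Fintype.card K - 1 := Nat.sub_pos_of_lt Fintype.one_lt_card
  have hF : 0 < Fintype.card F - 1 := Nat.sub_pos_of_lt Fintype.one_lt_card
  have hA0 : A ≠ 0 := by rintro rfl; omega
  refine Subgroup.eq_of_le_of_card_ge ?_ ?_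
  · rintro _ ⟨y, rfl⟩
    obtain ⟨j, hj⟩ := Subgroup.mem_zpowers_iff.1 (hα (Units.map (algebraMap K F : K →* F) y))
    have h1 : α ^ (j * ((Fintype.card K - 1 : ℕ) : ℤ)) = 1 := by
      rw [zpow_mul, hj, zpow_natCast, ← map_pow, ← Fintype.card_units, pow_card_eq_one, map_one]
    rw [← orderOf_dvd_iff_zpow_eq_one, hord, hA, Nat.cast_mul] at h1
    obtain ⟨k, rfl⟩ := Int.dvd_of_mul_dvd_mul_right (by exact_mod_cast hK.ne') h1
    exact Subgroup.mem_zpowers_iff.2 ⟨k, by rw [← hj, zpow_mul, zpow_natCast]⟩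
  · rw [Nat.card_zpowers, orderOf_pow_of_dvd hA0 (by rw [hord, hA]; exact dvd_mul_right _ _), hord,
      hA, Nat.mul_div_cancel_left _ (Nat.pos_of_ne_zero hA0),
      Nat.card_congr (MonoidHom.ofInjective (Units.map_injective
        (f := (algebraMap K F : K →* F)) (algebraMap K F).injective)).toEquiv.symm,
      Nat.card_eq_fintype_card, Fintype.card_units]

theorem Subgroup.zpowers_pow_sup_zpowers_pow {G : Type*} [CommGroup G] (x : G) (a b : ℕ) :
    zpowers (x ^ a) ⊔ zpowers (x ^ b) = zpowers (x ^ Nat.gcd a b) := by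
  apply le_antisymm
  · rw [sup_le_iff, zpowers_le, zpowers_le]
    constructor
    · obtain ⟨k, hk⟩ := Nat.gcd_dvd_left a b
      exact mem_zpowers_iff.2 ⟨k, by rw [zpow_natCast, ← pow_mul, ← hk]⟩
    · obtain ⟨k, hk⟩ := Nat.gcd_dvd_right a b
      exact mem_zpowers_iff.2 ⟨k, by rw [zpow_natCast, ← pow_mul, ← hk]⟩
  · rw [zpowers_le, ← zpow_natCast x (Nat.gcd a b), Nat.gcd_eq_gcd_ab, zpow_add, zpow_mul, zpow_mul, zpow_natCast,
      zpow_natCast]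
    exact mul_mem (le_sup_left (a := zpowers (x ^ a)) (zpow_mem (mem_zpowers _) _))
      (le_sup_right (a := zpowers (x ^ a)) (zpow_mem (mem_zpowers _) _))

theorem sum_range_orderOf_pow {G M : Type*} [Group G] [Fintype G] [AddCommMonoid M] (x : G)
    (φ : G → M) :
    ∑ j ∈ Finset.range (orderOf x), φ (x ^ j) = ∑ y : Subgroup.zpowers x, φ y := by
  rw [Finset.sum_range, ← Equiv.sum_comp (finEquivZPowers (isOfFinOrder_of_finite x))]
  rfl

/-- The products of the units of a finite subfield with the powers of `α ^ B` run
uniformly through the powers of `α ^ N`, where `N` is the greatest common divisor of `B` and the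
index of the subfield units. -/
theorem sum_units_mul_pow {K F M : Type*} [Field K] [Field F] [Algebra K F]
    [Fintype K] [Fintype F] [AddCommMonoid M] {α : Fˣ} (hα : ∀ x : Fˣ, x ∈ Subgroup.zpowers α)
    {A B L N k h : ℕ} (hA : Fintype.card F - 1 = A * (Fintype.card K - 1))
    (hB : Fintype.card F - 1 = B * L) (hN : Nat.gcd A B = N) (hk : Fintype.card F - 1 = N * k)
    (hh : L * (Fintype.card K - 1) = h * k) (φ : Fˣ → M) :
    ∑ j ∈ Finset.range L, ∑ y : Kˣ, φ (Units.map (algebraMap K F : K →* F) y * (α ^ B) ^ j) =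
      h • ∑ z : Subgroup.zpowers (α ^ N), φ z := by
  have hF : 0 < Fintype.card F - 1 := Nat.sub_pos_of_lt Fintype.one_lt_card
  have hord : orderOf α = Fintype.card F - 1 := by
    rw [orderOf_eq_card_of_forall_mem_zpowers hα, Nat.card_eq_fintype_card, Fintype.card_units]
  have orderOf_pow_left : ∀ {a b : ℕ}, Fintype.card F - 1 = a * b → orderOf (α ^ a) = b := by
    intro a b hab
    have ha : a ≠ 0 := by rintro rfl; omega
    rw [orderOf_pow_of_dvd ha (by rw [hord, hab]; exact dvd_mul_right _ _), hord, hab,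
      Nat.mul_div_cancel_left _ (Nat.pos_of_ne_zero ha)]
  let f : Kˣ × Subgroup.zpowers (α ^ B) →* Fˣ :=
    (Units.map (algebraMap K F : K →* F)).coprod (Subgroup.zpowers (α ^ B)).subtype
  have hrange : f.range = Subgroup.zpowers (α ^ N) := by
    rw [← hN, ← Subgroup.zpowers_pow_sup_zpowers_pow,
      ← range_unitsMap_algebraMap_eq_zpowers (K := K) hα hA]
    ext z
    simp [f, Subgroup.mem_sup, Subgroup.mem_zpowers_iff]
  have hker : Nat.card f.ker = h := by
    have h1 := Subgroup.card_mul_index f.ker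
    rw [Subgroup.index_ker, hrange, Nat.card_zpowers, orderOf_pow_left hk, Nat.card_prod,
      Nat.card_zpowers, orderOf_pow_left hB, Nat.card_eq_fintype_card (α := Kˣ),
      Fintype.card_units, mul_comm (Fintype.card K - 1), hh] at h1
    exact Nat.eq_of_mul_eq_mul_right (Nat.pos_of_ne_zero (by rintro rfl; omega)) h1
  have key := f.sum_comp_eq_card_ker_nsmul 
    (Finset.univ.filter (· ∈ Subgroup.zpowers (α ^ N))) (by simp [hrange]) φ
  rw [hker, Fintype.sum_prod_type_right] at key
  rw [← orderOf_pow_left hB, sum_range_orderOf_pow (α ^ B)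
    (fun x => ∑ y : Kˣ, φ (Units.map (algebraMap K F : K →* F) y * x))]
  refine key.trans ?_
  congr 1
  exact Finset.sum_subtype _ (by simp) _

/-- Orthogonality of the characters `y ↦ ψ (y x)` of the subfield `K`. -/
theorem sum_stdAddChar_trace_algebraMap_mul {p : ℕ} [Fact p.Prime] {K F : Type*} [Field K]
    [Field F] [Algebra K F] [Fintype K] [Fintype F] [Algebra (ZMod p) F] (x : F) :
    ∑ y : K, ZMod.stdAddChar (Algebra.trace (ZMod p) F (algebraMap K F y * x)) =
      if Algebra.trace K F x = 0 then (Fintype.card K : ℂ) else 0 := by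
  have : CharP F p := charP_of_injective_algebraMap (algebraMap (ZMod p) F).injective p
  have : CharP K p := (Algebra.charP_iff K F p).2 this
  let : Algebra (ZMod p) K := ZMod.algebra K p
  have : IsScalarTower (ZMod p) K F := IsScalarTower.of_algebraMap_eq' (Subsingleton.elim _ _)
  let χ : AddChar K ℂ :=
    (ZMod.stdAddChar (N := p)).compAddMonoidHom (Algebra.trace (ZMod p) K).toAddMonoidHom
  have hχ : χ.IsPrimitive := by
    refine AddChar.IsPrimitive.of_ne_one fun h => ?_
    obtain ⟨y, hy⟩ := Algebra.trace_surjective (ZMod p) K 1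
    have h1 : ZMod.stdAddChar (N := p) 1 = 1 := by
      rw [← hy]; exact DFunLike.congr_fun h y
    exact one_ne_zero (ZMod.injective_stdAddChar (h1.trans (AddChar.map_zero_eq_one _).symm))
  have key := AddChar.sum_mulShift (Algebra.trace K F x) hχ
  rw [Nat.cast_ite, Nat.cast_zero] at key
  rw [← key]
  refine Finset.sum_congr rfl fun y _ => ?_
  change _ = ZMod.stdAddChar (Algebra.trace (ZMod p) K (y * Algebra.trace K F x))
  rw [← smul_eq_mul y, ← map_smul, Algebra.trace_trace, Algebra.smul_def]

theorem Finset.sum_range_three_mul {M : Type*} [AddCommMonoid M] (f : ℕ → M) (L : ℕ) :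
    ∑ i ∈ range (3 * L), f i =
      ∑ j ∈ range L, f (3 * j) + ∑ j ∈ range L, f (3 * j + 1) + ∑ j ∈ range L, f (3 * j + 2) := by
  induction L with
  | zero => simp
  | succ L ih =>
    rw [Nat.mul_succ, sum_range_succ, sum_range_succ, sum_range_succ, ih, sum_range_succ,
      sum_range_succ, sum_range_succ]
    abel

theorem mem_zpowers_pow_iff_exists_pow_eq {F : Type*} [Field F] {α : Fˣ}
    (hα : ∀ x : Fˣ, x ∈ Subgroup.zpowers α) {N : ℕ} (hN : N ≠ 0) (z : Fˣ) :
    z ∈ Subgroup.zpowers (α ^ N) ↔ ∃ y : F, y ^ N = z := by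
  constructor
  · intro hz
    obtain ⟨i, rfl⟩ := Subgroup.mem_zpowers_iff.1 hz
    refine ⟨((α ^ i : Fˣ) : F), ?_⟩
    rw [← Units.val_pow_eq_pow_val, ← zpow_natCast, ← zpow_natCast, ← zpow_mul, ← zpow_mul,
      mul_comm]
  · rintro ⟨y, hy⟩
    have hy0 : y ≠ 0 := by
      rintro rfl
      exact z.ne_zero (by rw [← hy, zero_pow hN])
    obtain ⟨i, hi⟩ := Subgroup.mem_zpowers_iff.1 (hα (Units.mk0 y hy0))
    refine Subgroup.mem_zpowers_iff.2 ⟨i, ?_⟩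
    have hz : z = Units.mk0 y hy0 ^ N := by
      ext
      rw [Units.val_pow_eq_pow_val, Units.val_mk0, hy]
    rw [hz, ← hi, ← zpow_natCast, ← zpow_natCast, ← zpow_mul, ← zpow_mul, mul_comm]

theorem sum_zpowers_pow_eq_sum_filter {F M : Type*} [Field F] [Fintype F] [AddCommMonoid M]
    {α : Fˣ} (hα : ∀ x : Fˣ, x ∈ Subgroup.zpowers α) {N : ℕ} (hN : N ≠ 0) (φ : F → M) :
    ∑ z : Subgroup.zpowers (α ^ N), φ (z : Fˣ) =
      ∑ z ∈ Finset.univ.filter (fun x : F => x ≠ 0 ∧ ∃ y : F, y ^ N = x), φ z := by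
  refine Finset.sum_bij (fun z _ => ((z : Fˣ) : F)) ?_ ?_ ?_ (fun _ _ => rfl)
  · intro z _
    simpa using (mem_zpowers_pow_iff_exists_pow_eq hα hN _).1 z.2
  · intro z _ z' _ hzz
    exact Subtype.ext (Units.ext hzz)
  · intro x hx
    obtain ⟨hx0, hx⟩ := (Finset.mem_filter.1 hx).2
    exact ⟨⟨Units.mk0 x hx0, (mem_zpowers_pow_iff_exists_pow_eq hα hN _).2 hx⟩,
      Finset.mem_univ _, rfl⟩

/-- Sums over the nonzero `N`-th powers are invariant under multiplication by an `N`-th power. -/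
theorem sum_filter_pow_mul_eq {F M : Type*} [Field F] [Fintype F] [AddCommMonoid M] {N : ℕ}
    (φ : F → M) {c : F} (hc : c ≠ 0) (u : F) :
    ∑ z ∈ Finset.univ.filter (fun x : F => x ≠ 0 ∧ ∃ y : F, y ^ N = x), φ (z * (c ^ N * u)) =
      ∑ z ∈ Finset.univ.filter (fun x : F => x ≠ 0 ∧ ∃ y : F, y ^ N = x), φ (z * u) := by
  refine Finset.sum_bij' (fun z _ => z * c ^ N) (fun z _ => z * (c⁻¹) ^ N) ?_ ?_ ?_ ?_ ?_
  · intro z hz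
    obtain ⟨hz0, y, rfl⟩ := (Finset.mem_filter.1 hz).2
    exact Finset.mem_filter.2
      ⟨Finset.mem_univ _, mul_ne_zero hz0 (pow_ne_zero _ hc), y * c, mul_pow _ _ _⟩
  · intro z hz
    obtain ⟨hz0, y, rfl⟩ := (Finset.mem_filter.1 hz).2
    exact Finset.mem_filter.2
      ⟨Finset.mem_univ _, mul_ne_zero hz0 (pow_ne_zero _ (inv_ne_zero hc)), y * c⁻¹,
        mul_pow _ _ _⟩
  · intro z _
    simp [hc]
  · intro z _
    simp [hc]
  · intro z _
    rw [mul_assoc]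

theorem Fintype.sum_eq_zero_add_sum_units {K M : Type*} [GroupWithZero K] [Fintype K]
    [AddCommMonoid M] (f : K → M) : ∑ y, f y = f 0 + ∑ y : Kˣ, f y := by
  rw [Fintype.sum_eq_add_sum_subtype_ne f 0]
  congr 1
  exact (Equiv.sum_comp unitsEquivNeZero fun y : {a : K // a ≠ 0} => f y).symm

theorem ncard_fin_add_card_filter_range (n : ℕ) (P : ℕ → Prop) :
    Set.ncard {i : Fin n | ¬ P i} + ((Finset.range n).filter P).card = n := by
  have h1 : Set.ncard {i : Fin n | ¬ P i} = ((Finset.range n).filter fun i => ¬ P i).card := by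
    rw [Set.ncard_eq_toFinset_card']
    refine Finset.card_bij (fun i _ => (i : ℕ)) ?_ ?_ ?_
    · intro i hi
      simpa using hi
    · intro i _ j _ hij
      exact Fin.ext hij
    · intro i hi
      obtain ⟨hi, hP⟩ := Finset.mem_filter.1 hi
      exact ⟨⟨i, Finset.mem_range.1 hi⟩, by simpa using hP, rfl⟩
  rw [h1, add_comm, Finset.card_filter_add_card_filter_not, Finset.card_range]

/-- For `e = N = 3`, the Hamming weights of the codewords `c_{(−β^t b, b)}`,
`t = 1, 2, 3`, are given by the stated formulas in terms of Gaussian periods. -/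
theorem stmt_17 (p s m h : ℕ) (hp : p.Prime) (hs : 1 ≤ s) (hm : 1 ≤ m)
    (q r : ℕ) (hq : q = p ^ s) (hr : r = q ^ m)
    (hh : 0 < h) (hhq : h ∣ q - 1)
    (he : 3 ∣ Nat.gcd (q - 1) (h * m))
    (hN : Nat.gcd ((r - 1) / (q - 1)) (3 * (q - 1) / h) = 3)
    (K F : Type) [Field K] [Field F] [Algebra K F] [Fintype K] [Fintype F]
    [Algebra (ZMod p) F]
    (hcardK : Fintype.card K = q) (hcardF : Fintype.card F = r)
    (α : Fˣ) (hα : ∀ x : Fˣ, x ∈ Subgroup.zpowers α)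
    (g β : F) (hg : g = (α : F) ^ ((q - 1) / h)) (hβ : β = (α : F) ^ ((r - 1) / 3))
    (n : ℕ) (hn : n = h * (r - 1) / (q - 1))
    (w : F → F → ℕ)
    (hw : ∀ a b : F, w a b = Set.ncard {i : Fin n |
      Algebra.trace K F (a * g ^ (i : ℕ) + b * (β * g) ^ (i : ℕ)) ≠ 0})
    (ψ : F → ℂ)
    (hψ : ∀ x : F, ψ x = Complex.exp (2 * Real.pi * Complex.I *
      (ZMod.val (Algebra.trace (ZMod p) F x)) / p))
    (η : F → ℂ)
    (hη : ∀ u : F, η u =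
      ∑ z ∈ Finset.univ.filter (fun x : F => x ≠ 0 ∧ ∃ y : F, y ^ 3 = x), ψ (z * u)) :
    ∀ b : F, b ≠ 0 →
      (w (-(β * b)) b : ℂ) = (h : ℂ) * ((r : ℂ) - 1) / q -
        (h : ℂ) / q * (((r : ℂ) - 1) / 3 + η (b * g ^ 2 * (β - 1)) + η (b * (β - 1))) ∧
      (w (-(β ^ 2 * b)) b : ℂ) = (h : ℂ) * ((r : ℂ) - 1) / q -
        (h : ℂ) / q * (((r : ℂ) - 1) / 3 + η (b * g * (β - 1)) + η (b * (β - 1))) ∧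
      (w (-b) b : ℂ) = (h : ℂ) * ((r : ℂ) - 1) / q -
        (h : ℂ) / q * (((r : ℂ) - 1) / 3 + η (b * g * (β - 1)) + η (b * g ^ 2 * (β - 1))) := by
  intro b hb
  have := Fact.mk hp
  have hq2 : 2 ≤ q := hcardK ▸ Fintype.one_lt_card
  have hr2 : 2 ≤ r := hcardF ▸ Fintype.one_lt_card
  obtain ⟨d, hd⟩ := hhq
  obtain ⟨e, he⟩ := he.trans (Nat.gcd_dvd_left _ _)
  obtain ⟨A, hA⟩ : q - 1 ∣ r - 1 := by
    simpa [hr] using Nat.sub_dvd_pow_sub_pow q 1 m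
  have hq0 : 0 < q - 1 := by omega
  rw [hA, Nat.mul_div_cancel_left _ hq0, show 3 * (q - 1) / h = 3 * d by
    rw [hd, Nat.mul_left_comm, Nat.mul_div_cancel_left _ hh]] at hN
  obtain ⟨A', rfl⟩ : 3 ∣ A := hN ▸ Nat.gcd_dvd_left A (3 * d)
  have hk : r - 1 = 3 * (A' * (q - 1)) := by rw [hA]; ring
  have hL : n = 3 * (h * A') := by
    rw [hn, hA, show h * ((q - 1) * (3 * A')) = (q - 1) * (3 * (h * A')) by ring,
      Nat.mul_div_cancel_left _ hq0]
  rw [hd, Nat.mul_div_cancel_left _ hh] at hg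
  rw [hk, Nat.mul_div_cancel_left _ (by norm_num)] at hβ
  have hβ3 : β ^ 3 = 1 := by
    rw [hβ, ← pow_mul, mul_comm, ← hk, ← hcardF]
    exact FiniteField.pow_card_sub_one_eq_one _ α.ne_zero
  obtain ⟨c, hcβ⟩ : ∃ c : F, c ^ 3 = β := ⟨α ^ (A' * e), by rw [hβ, he, ← pow_mul]; ring_nf⟩
  have hc : c ≠ 0 := by
    rintro rfl
    rw [← hcβ] at hβ3
    norm_num at hβ3
  have hψ' : ∀ x, ψ x = ZMod.stdAddChar (Algebra.trace (ZMod p) F x) := by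
    intro x
    rw [hψ, ZMod.stdAddChar_apply, ZMod.toCircle_apply]
  have hrC : (r : ℂ) - 1 = 3 * (A' * (q - 1)) := by
    have := congrArg (Nat.cast : ℕ → ℂ) hk
    push_cast [Nat.cast_sub (show 1 ≤ r by omega), Nat.cast_sub (show 1 ≤ q by omega)] at this
    exact this
  have hψ0 : ψ 0 = 1 := by rw [hψ', map_zero, AddChar.map_zero_eq_one]
  have hηmul : ∀ (c u : F), c ≠ 0 → η (c ^ 3 * u) = η u := by
    intro c u hc
    rw [hη, hη]
    exact sum_filter_pow_mul_eq ψ hc u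
  have hηneg : ∀ u, η (-u) = η u := by
    intro u
    rw [← hηmul (-1) u (by simp)]
    congr 1
    ring
  have hηβ : ∀ u, η (β * u) = η u := fun u => by rw [← hcβ, hηmul c u hc]
  have hcoset : ∀ φ : F → ℂ,
      ∑ j ∈ Finset.range (h * A'), ∑ y : Kˣ, φ (algebraMap K F y * (g ^ 3) ^ j) =
        h * ∑ z ∈ Finset.univ.filter (fun x : F => x ≠ 0 ∧ ∃ y : F, y ^ 3 = x), φ z := by
    intro φ
    have key := sum_units_mul_pow (K := K) hα (A := 3 * A') (B := 3 * d) (L := h * A') (N := 3)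
      (k := A' * (q - 1)) (h := h) (by rw [hcardF, hcardK, hA]; ring)
      (by rw [hcardF, hk, hd]; ring) hN (by rw [hcardF, hk]) (by rw [hcardK]; ring)
      (fun z => φ (z : F))
    rw [sum_zpowers_pow_eq_sum_filter hα three_ne_zero, nsmul_eq_mul] at key
    rw [← key, hg]
    refine Finset.sum_congr rfl fun j _ => Finset.sum_congr rfl fun y _ => ?_
    congr 1
    push_cast
    rw [← pow_mul (α : F) d 3, mul_comm d 3]
    rfl
  have hS : ∀ u : F, ∑ j ∈ Finset.range (h * A'), ∑ y : K, ψ (algebraMap K F y * ((g ^ 3) ^ j * u))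
      = h * A' + h * η u := by
    intro u
    simp_rw [Fintype.sum_eq_zero_add_sum_units, map_zero, zero_mul, hψ0, Finset.sum_add_distrib, ← mul_assoc]
    rw [hcoset (fun z => ψ (z * u)), ← hη]
    simp
  have hη0 : η 0 = (r - 1) / 3 := by
    have h1 := hS 0
    simp only [mul_zero, hψ0, Finset.sum_const, Finset.card_univ, Finset.card_range, hcardK,
      nsmul_eq_mul, mul_one, Nat.cast_mul] at h1
    have hh' : (h : ℂ) ≠ 0 := by exact_mod_cast hh.ne'
    rw [hrC]
    apply mul_left_cancel₀ hh'
    linear_combination -h1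
  have hweight : ∀ a : F, (w a b : ℂ) = h * (r - 1) / q -
      h / q * (η (a + b) + η (g * (a + β * b)) + η (g ^ 2 * (a + β ^ 2 * b))) := by
    intro a
    have hcount := ncard_fin_add_card_filter_range n
      (fun i => Algebra.trace K F (a * g ^ i + b * (β * g) ^ i) = 0)
    rw [← hw] at hcount
    have hzero : (q : ℂ) * (((Finset.range n).filter
        (fun i => Algebra.trace K F (a * g ^ i + b * (β * g) ^ i) = 0)).card : ℂ) =
        3 * (h * A') +
          h * (η (a + b) + η (g * (a + β * b)) + η (g ^ 2 * (a + β ^ 2 * b))) := by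
      have h1 : ∀ i, (∑ y : K, ψ (algebraMap K F y * (a * g ^ i + b * (β * g) ^ i))) =
          if Algebra.trace K F (a * g ^ i + b * (β * g) ^ i) = 0 then (q : ℂ) else 0 := by
        intro i
        simp_rw [hψ']
        rw [sum_stdAddChar_trace_algebraMap_mul, hcardK]
      have hβj : ∀ j, β ^ (3 * j) = 1 := fun j => by rw [pow_mul, hβ3, one_pow]
      rw [mul_comm, ← nsmul_eq_mul, ← Finset.sum_const, Finset.sum_filter]
      simp_rw [← h1]
      rw [hL, Finset.sum_range_three_mul]
      have e0 : ∀ j, a * g ^ (3 * j) + b * (β * g) ^ (3 * j) = (g ^ 3) ^ j * (a + b) := by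
        intro j
        rw [mul_pow, hβj, ← pow_mul]
        ring
      have e1 : ∀ j, a * g ^ (3 * j + 1) + b * (β * g) ^ (3 * j + 1) =
          (g ^ 3) ^ j * (g * (a + β * b)) := by
        intro j
        rw [mul_pow, pow_succ β, hβj, ← pow_mul]
        ring
      have e2 : ∀ j, a * g ^ (3 * j + 2) + b * (β * g) ^ (3 * j + 2) =
          (g ^ 3) ^ j * (g ^ 2 * (a + β ^ 2 * b)) := by
        intro j
        rw [mul_pow, pow_add β, hβj, ← pow_mul]
        ring
      simp_rw [e0, e1, e2, hS]
      ring
    have hcount' := congrArg (Nat.cast : ℕ → ℂ) hcount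
    rw [hL] at hcount'
    rw [hL] at hzero
    push_cast at hcount'
    have hqC : (q : ℂ) ≠ 0 := by exact_mod_cast (show q ≠ 0 by omega)
    rw [div_mul_eq_mul_div, ← sub_div, eq_div_iff hqC]
    linear_combination q * hcount' - hzero - h * hrC
  refine ⟨?_, ?_, ?_⟩
  · rw [hweight, show -(β * b) + b = -(b * (β - 1)) by ring,
      show g * (-(β * b) + β * b) = 0 by ring,
      show g ^ 2 * (-(β * b) + β ^ 2 * b) = β * (b * g ^ 2 * (β - 1)) by ring,
      hηneg, hηβ, hη0]
    ring
  · rw [hweight, show -(β ^ 2 * b) + b = β * (β * (b * (β - 1))) by linear_combination -b * hβ3,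
      show g * (-(β ^ 2 * b) + β * b) = -(β * (b * g * (β - 1))) by ring,
      show g ^ 2 * (-(β ^ 2 * b) + β ^ 2 * b) = 0 by ring,
      hηneg, hηβ, hηβ, hηβ, hη0]
    ring
  · rw [hweight, show -b + b = 0 by ring,
      show g * (-b + β * b) = b * g * (β - 1) by ring,
      show g ^ 2 * (-b + β ^ 2 * b) = -(β * (β * (b * g ^ 2 * (β - 1)))) by
        linear_combination g ^ 2 * b * hβ3,
      hηneg, hηβ, hηβ, hη0]
end
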